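/- arXiv:2104.06539 — 13 statements merged into one kernel-verified Lean document; each statement's English description precedes it below -/
import Mathlib

section
/- For every finite distributive lattice D there exists a finite lattice L such that D is order-isomorphic to the set of all congruences of L ordered by inclusion (the Basic Representation Theorem of Dilworth / Grätzer–Schmidt). -/
/-- A congruence of a lattice `L`: an equivalence relation compatible with `⊓` and `⊔`. -/
def IsLatCongr {L : Type*} [Lattice L] (r : L → L → Prop) : Prop :=
  Equivalence r ∧
    ∀ x y u v : L, r x y → r u v → r (x ⊓ u) (y ⊓ v) ∧ r (x ⊔ u) (y ⊔ v)

/-- A set of points of `P × Fin 3` is saturated if, whenever it contains a point over `q` and a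
distinct point over some `p ≥ q`, it contains all points over `q`. -/
def IsSaturated {P : Type*} [PartialOrder P] (A : Set (P × Fin 3)) : Prop :=
  ∀ ⦃x y⦄, x ∈ A → y ∈ A → x ≠ y → y.1 ≤ x.1 → ∀ k, (y.1, k) ∈ A

/-- The lattice of saturated sets. Its congruences correspond to the lower sets of `P`. -/
abbrev SaturatedSet (P : Type*) [PartialOrder P] := {A : Set (P × Fin 3) // IsSaturated A}

namespace SaturatedSet

variable {P : Type*} [PartialOrder P]

instance : Lattice (SaturatedSet P) where
  inf A B := ⟨A.1 ∩ B.1, fun _ _ hx hy hne hle k =>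
    ⟨A.2 hx.1 hy.1 hne hle k, B.2 hx.2 hy.2 hne hle k⟩⟩
  inf_le_left _ _ := Set.inter_subset_left
  inf_le_right _ _ := Set.inter_subset_right
  le_inf _ _ _ := Set.subset_inter
  sup A B := ⟨{x | ∀ C : SaturatedSet P, A ≤ C → B ≤ C → x ∈ C.1},
    fun _ _ hx hy hne hle k C hA hB => C.2 (hx C hA hB) (hy C hA hB) hne hle k⟩
  le_sup_left _ _ _ hx _ hA _ := hA hx
  le_sup_right _ _ _ hx _ _ hB := hB hx
  sup_le _ _ C hA hB _ hx := hx C hA hB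

instance : OrderBot (SaturatedSet P) where
  bot := ⟨∅, fun _ _ hx => hx.elim⟩
  bot_le _ _ hx := hx.elim

/-- A single point, as a saturated set. -/
def atom (x : P × Fin 3) : SaturatedSet P :=
  ⟨{x}, fun _ _ hy hz hne => (hne (hy.trans hz.symm)).elim⟩

theorem atom_le {x : P × Fin 3} {A : SaturatedSet P} : atom x ≤ A ↔ x ∈ A.1 :=
  Set.singleton_subset_iff

theorem atom_inf_eq_bot {x : P × Fin 3} {A : SaturatedSet P} (h : x ∉ A.1) : atom x ⊓ A = ⊥ :=
  Subtype.ext (Set.singleton_inter_eq_empty.2 h)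

theorem mem_sup_atom {x y : P × Fin 3} (hne : x ≠ y) (hle : y.1 ≤ x.1) (k : Fin 3) :
    (y.1, k) ∈ (atom x ⊔ atom y).1 :=
  (atom x ⊔ atom y).2 (atom_le.1 le_sup_left) (atom_le.1 le_sup_right) hne hle k

/-- The union of a saturated set with all points over a lower set. -/
def adjoin (S : LowerSet P) (A : SaturatedSet P) : SaturatedSet P :=
  ⟨{x | x.1 ∈ S ∨ x ∈ A.1}, by
    intro x y hx hy hne hle k
    by_cases hS : y.1 ∈ S
    · exact Or.inl hS
    · exact Or.inr (A.2 (hx.resolve_left fun h => hS (S.lower hle h)) (hy.resolve_left hS)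
        hne hle k)⟩

theorem le_adjoin (S : LowerSet P) (A : SaturatedSet P) : A ≤ adjoin S A := fun _ => Or.inr

theorem adjoin_mono (S : LowerSet P) : Monotone (adjoin S) := fun _ _ h _ => Or.imp_right (@h _)

theorem adjoin_le_adjoin {S : LowerSet P} {A B : SaturatedSet P} (h : A ≤ adjoin S B) :
    adjoin S A ≤ adjoin S B := fun _ hx => hx.elim Or.inl (@h _)

theorem adjoin_inf (S : LowerSet P) (A B : SaturatedSet P) :
    adjoin S (A ⊓ B) = adjoin S A ⊓ adjoin S B :=
  Subtype.ext (Set.ext fun _ => or_and_left)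

theorem adjoin_sup_le {S : LowerSet P} {A B C D : SaturatedSet P}
    (hAB : adjoin S A = adjoin S B) (hCD : adjoin S C = adjoin S D) :
    adjoin S (A ⊔ C) ≤ adjoin S (B ⊔ D) :=
  adjoin_le_adjoin <| sup_le
    (((le_adjoin S A).trans hAB.le).trans (adjoin_mono S le_sup_left))
    (((le_adjoin S C).trans hCD.le).trans (adjoin_mono S le_sup_right))

theorem isLatCongr_adjoin (S : LowerSet P) :
    IsLatCongr fun A B : SaturatedSet P => adjoin S A = adjoin S B :=
  ⟨⟨fun _ => rfl, Eq.symm, Eq.trans⟩, fun A B C D hAB hCD =>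
    ⟨by simp only [adjoin_inf, hAB, hCD],
      (adjoin_sup_le hAB hCD).antisymm (adjoin_sup_le hAB.symm hCD.symm)⟩⟩

theorem adjoin_bot_eq_adjoin_atom {S : LowerSet P} {x : P × Fin 3} :
    adjoin S ⊥ = adjoin S (atom x) ↔ x.1 ∈ S := by
  refine ⟨fun h => ?_, fun h => (adjoin_mono S bot_le).antisymm (adjoin_le_adjoin ?_)⟩
  · have hx : x ∈ (adjoin S ⊥).1 := h ▸ le_adjoin S _ rfl
    exact hx.resolve_right id
  · exact atom_le.2 (Or.inl h)

section Congruence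

variable {r : SaturatedSet P → SaturatedSet P → Prop}

theorem rel_bot_atom_of_rel (hr : IsLatCongr r) {A B : SaturatedSet P} (h : r A B) {x : P × Fin 3}
    (hA : x ∉ A.1) (hB : x ∈ B.1) : r ⊥ (atom x) := by
  have := (hr.2 _ _ _ _ (hr.1.refl (atom x)) h).1
  rwa [atom_inf_eq_bot hA, inf_eq_left.2 (atom_le.2 hB)] at this

theorem rel_bot_atom_of_le (hr : IsLatCongr r) {x y : P × Fin 3} (hx : r ⊥ (atom x)) (hne : x ≠ y)
    (hle : y.1 ≤ x.1) {k : Fin 3} (hk : (y.1, k) ≠ y) : r ⊥ (atom (y.1, k)) := by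
  have := (hr.2 _ _ _ _ hx (hr.1.refl (atom y))).2
  rw [bot_sup_eq] at this
  exact rel_bot_atom_of_rel hr this hk (mem_sup_atom hne hle k)

theorem rel_bot_atom_down (hr : IsLatCongr r) {x y : P × Fin 3} (hx : r ⊥ (atom x))
    (hle : y.1 ≤ x.1) : r ⊥ (atom y) := by
  obtain ⟨q, k⟩ := y
  obtain ⟨j, hjk, hj⟩ : ∃ j : Fin 3, k ≠ j ∧ x.2 ≠ j :=
    (by decide : ∀ k i : Fin 3, ∃ j, k ≠ j ∧ i ≠ j) k x.2
  exact rel_bot_atom_of_le hr (y := (q, j)) hx (fun h => hj (congrArg Prod.snd h)) hle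
    fun h => hjk (congrArg Prod.snd h)

/-- The elements of `P` whose points are identified with `⊥` by a congruence. -/
def kernel (hr : IsLatCongr r) : LowerSet P where
  carrier := {p | r ⊥ (atom (p, 0))}
  lower' _ _ hle h := rel_bot_atom_down hr h hle

theorem fst_mem_kernel (hr : IsLatCongr r) {x : P × Fin 3} : x.1 ∈ kernel hr ↔ r ⊥ (atom x) :=
  ⟨fun h => rel_bot_atom_down hr (x := (x.1, 0)) h le_rfl,
    fun h => rel_bot_atom_down hr (y := (x.1, 0)) h le_rfl⟩

theorem le_adjoin_kernel_of_rel (hr : IsLatCongr r) {A B : SaturatedSet P} (h : r A B) :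
    B ≤ adjoin (kernel hr) A := by
  intro x hx
  by_cases hA : x ∈ A.1
  · exact Or.inr hA
  · exact Or.inl ((fst_mem_kernel hr).2 (rel_bot_atom_of_rel hr h hA hx))

theorem rel_adjoin_kernel [Finite P] (hr : IsLatCongr r) (A : SaturatedSet P) :
    r A (adjoin (kernel hr) A) := by
  classical
  have := Fintype.ofFinite P
  let T := (Finset.univ.filter fun x : P × Fin 3 => x.1 ∈ kernel hr).sup atom
  have hT : r ⊥ T := by
    refine Finset.sup_induction (p := r ⊥) (hr.1.refl _) (fun B hB C hC => ?_) fun x hx => ?_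
    · simpa using (hr.2 _ _ _ _ hB hC).2
    · exact (fst_mem_kernel hr).1 (Finset.mem_filter.1 hx).2
  have hAT := (hr.2 _ _ _ _ (hr.1.refl A) hT).2
  rw [sup_bot_eq] at hAT
  have hle : adjoin (kernel hr) A ≤ A ⊔ T := by
    rintro x (hx | hx)
    · have hxT : atom x ≤ T := Finset.le_sup (Finset.mem_filter.2 ⟨Finset.mem_univ x, hx⟩)
      exact atom_le.1 (hxT.trans le_sup_right)
    · exact (le_sup_left : A ≤ A ⊔ T) hx
  have := (hr.2 _ _ _ _ hAT (hr.1.refl (adjoin (kernel hr) A))).1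
  rwa [inf_eq_left.2 (le_adjoin _ A), inf_eq_right.2 hle] at this

theorem rel_iff_adjoin_kernel_eq [Finite P] (hr : IsLatCongr r) {A B : SaturatedSet P} :
    r A B ↔ adjoin (kernel hr) A = adjoin (kernel hr) B := by
  refine ⟨fun h => ?_, fun h => ?_⟩
  · exact (adjoin_le_adjoin (le_adjoin_kernel_of_rel hr (hr.1.symm h))).antisymm
      (adjoin_le_adjoin (le_adjoin_kernel_of_rel hr h))
  · exact hr.1.trans (rel_adjoin_kernel hr A) (h ▸ hr.1.symm (rel_adjoin_kernel hr B))

end Congruence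

/-- The congruences of the lattice of saturated sets correspond to the lower sets of `P`. -/
def lowerSetEquivCongr [Finite P] :
    LowerSet P ≃ {r : SaturatedSet P → SaturatedSet P → Prop // IsLatCongr r} where
  toFun S := ⟨_, isLatCongr_adjoin S⟩
  invFun r := kernel r.2
  left_inv _ := LowerSet.ext (Set.ext fun _ => adjoin_bot_eq_adjoin_atom)
  right_inv r := Subtype.ext <| funext₂ fun _ _ =>
    propext (rel_iff_adjoin_kernel_eq r.2).symm

theorem le_iff_lowerSetEquivCongr [Finite P] {S T : LowerSet P} :
    S ≤ T ↔ ∀ A B, (lowerSetEquivCongr S).1 A B → (lowerSetEquivCongr T).1 A B := by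
  refine ⟨fun h A B hAB => ?_, fun h p hp => ?_⟩
  · have key {A B : SaturatedSet P} (hAB : adjoin S A = adjoin S B) : A ≤ adjoin T B :=
      fun x hx => (hAB.le (le_adjoin S A hx)).imp_left (@h _)
    exact (adjoin_le_adjoin (key hAB)).antisymm (adjoin_le_adjoin (key hAB.symm))
  · exact adjoin_bot_eq_adjoin_atom.1
      (h ⊥ (atom (p, 0)) (adjoin_bot_eq_adjoin_atom.2 hp))

end SaturatedSet

/-- **Basic Representation Theorem** (Dilworth / Grätzer–Schmidt): every finite
distributive lattice `D` is order-isomorphic to the set of all congruences of some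
finite lattice `L`, ordered by inclusion. -/
theorem basic_representation_theorem (D : Type*) [DistribLattice D] [Fintype D]
    [Nonempty D] :
    ∃ (L : Type) (instL : Lattice L) (_ : Fintype L)
      (e : D ≃ {r : L → L → Prop // @IsLatCongr L instL r}),
      ∀ a b : D, a ≤ b ↔ ∀ x y : L, (e a).1 x y → (e b).1 x y := by
  classical
  let _ : OrderBot D := Fintype.toOrderBot D
  let P := Shrink.{0} {a : D // SupIrred a}
  let e : D ≃o LowerSet P :=
    OrderIso.lowerSetSupIrred.trans (LowerSet.map (orderIsoShrink _))
  have : Finite P := Finite.of_equiv _ (equivShrink _)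
  exact ⟨SaturatedSet P, inferInstance, Fintype.ofFinite _,
    e.toEquiv.trans SaturatedSet.lowerSetEquivCongr,
    fun _ _ => e.le_iff_le.symm.trans SaturatedSet.le_iff_lowerSetEquivCongr⟩
end

section
/- For any lattice L, the congruence lattice of L is distributive: for all congruences α, β, γ of L, the intersection of α with the join of β and γ equals the join of (α ∩ β) and (α ∩ γ), where the join of two congruences is the least congruence containing both (Funayama–Nakayama Theorem). -/
/-- The join of two congruences: the least congruence containing both, obtained as
the intersection of all congruences containing both. -/
def congSup {L : Type*} [Lattice L] (r s : L → L → Prop) : L → L → Prop :=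
  fun x y => ∀ t : L → L → Prop, IsLatCongr t →
    (∀ a b, r a b → t a b) → (∀ a b, s a b → t a b) → t x y

/-- Two elements related by a lattice congruence have related images under `c ⊔ (d ⊓ ·)`. -/
theorem IsLatCongr.sup_inf_left {L : Type*} [Lattice L] {r : L → L → Prop} (hr : IsLatCongr r)
    (c d : L) {u v : L} (h : r u v) : r (c ⊔ (d ⊓ u)) (c ⊔ (d ⊓ v)) :=
  (hr.2 _ _ _ _ (hr.1.refl c) (hr.2 _ _ _ _ (hr.1.refl d) h).1).2

/-- If `x` and `y` are congruent, then so are `x` and every element of the form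
`(x ⊓ y) ⊔ ((x ⊔ y) ⊓ u)`. -/
theorem IsLatCongr.inf_sup_sup_inf {L : Type*} [Lattice L] {r : L → L → Prop}
    (hr : IsLatCongr r) {x y : L} (h : r x y) (u : L) : r x ((x ⊓ y) ⊔ ((x ⊔ y) ⊓ u)) := by
  have key := hr.2 _ _ _ _ (hr.1.refl x) h
  rw [inf_idem, sup_idem] at key
  have := (hr.2 _ _ _ _ key.1 (hr.2 _ _ _ _ key.2 (hr.1.refl u)).1).2
  rwa [sup_inf_self] at this

/-- The equivalence relation generated by two lattice congruences is a lattice congruence. -/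
theorem IsLatCongr.eqvGen_or {L : Type*} [Lattice L] {r s : L → L → Prop}
    (hr : IsLatCongr r) (hs : IsLatCongr s) :
    IsLatCongr (Relation.EqvGen fun a b => r a b ∨ s a b) := by
  have lift {f : L → L} (hfr : ∀ a b, r a b → r (f a) (f b))
      (hfs : ∀ a b, s a b → s (f a) (f b)) {a b : L}
      (h : Relation.EqvGen (fun a b => r a b ∨ s a b) a b) :
      Relation.EqvGen (fun a b => r a b ∨ s a b) (f a) (f b) := by
    induction h with
    | rel a b h => exact .rel _ _ (h.imp (hfr a b) (hfs a b))
    | refl a => exact .refl _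
    | symm a b _ ih => exact .symm _ _ ih
    | trans a b c _ _ ih₁ ih₂ => exact .trans _ _ _ ih₁ ih₂
  refine ⟨Relation.EqvGen.is_equivalence _, fun x y u v hxy huv => ⟨?_, ?_⟩⟩
  · exact .trans _ (y ⊓ u) _
      (lift (f := (· ⊓ u)) (fun a b h => (hr.2 _ _ _ _ h (hr.1.refl u)).1)
        (fun a b h => (hs.2 _ _ _ _ h (hs.1.refl u)).1) hxy)
      (lift (f := (y ⊓ ·)) (fun a b h => (hr.2 _ _ _ _ (hr.1.refl y) h).1)
        (fun a b h => (hs.2 _ _ _ _ (hs.1.refl y) h).1) huv)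
  · exact .trans _ (y ⊔ u) _
      (lift (f := (· ⊔ u)) (fun a b h => (hr.2 _ _ _ _ h (hr.1.refl u)).2)
        (fun a b h => (hs.2 _ _ _ _ h (hs.1.refl u)).2) hxy)
      (lift (f := (y ⊔ ·)) (fun a b h => (hr.2 _ _ _ _ (hr.1.refl y) h).2)
        (fun a b h => (hs.2 _ _ _ _ (hs.1.refl y) h).2) huv)

/-- **Funayama–Nakayama Theorem**: for any lattice `L`, the congruence lattice of `L`
is distributive: `α ⊓ (β ⊔ γ) = (α ⊓ β) ⊔ (α ⊓ γ)`, where meets are intersections and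
the join of two congruences is the least congruence containing both. -/
theorem funayama_nakayama {L : Type*} [Lattice L] (α β γ : L → L → Prop)
    (hα : IsLatCongr α) (hβ : IsLatCongr β) (hγ : IsLatCongr γ) :
    ∀ x y : L, (α x y ∧ congSup β γ x y) ↔
      congSup (fun a b => α a b ∧ β a b) (fun a b => α a b ∧ γ a b) x y := by
  intro x y
  constructor
  · rintro ⟨hxy, hsup⟩ t ht hβt hγt
    have hgen := hsup _ (hβ.eqvGen_or hγ) (fun a b h => .rel _ _ (.inl h))
      (fun a b h => .rel _ _ (.inr h))
    have hmap : ∀ u v, Relation.EqvGen (fun a b => β a b ∨ γ a b) u v →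
        t ((x ⊓ y) ⊔ ((x ⊔ y) ⊓ u)) ((x ⊓ y) ⊔ ((x ⊔ y) ⊓ v)) := by
      intro u v h
      induction h with
      | rel u v h =>
        have hαuv := hα.1.trans (hα.1.symm (hα.inf_sup_sup_inf hxy u)) (hα.inf_sup_sup_inf hxy v)
        exact h.elim (fun h => hβt _ _ ⟨hαuv, hβ.sup_inf_left _ _ h⟩)
          (fun h => hγt _ _ ⟨hαuv, hγ.sup_inf_left _ _ h⟩)
      | refl u => exact ht.1.refl _
      | symm u v _ ih => exact ht.1.symm ih
      | trans u v w _ _ ih₁ ih₂ => exact ht.1.trans ih₁ ih₂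
    simpa using hmap x y hgen
  · intro h
    exact ⟨h α hα (fun _ _ h => h.1) (fun _ _ h => h.1), fun t ht hβt hγt =>
      h t ht (fun a b h => hβt a b h.2) (fun a b h => hγt a b h.2)⟩
end

section
/- Every finite lattice K has a finite, sectionally complemented, congruence-preserving extension: there exist a finite sectionally complemented lattice L and an injective lattice homomorphism f : K → L such that the map sending each congruence Θ of L to the congruence {(x, y) ∈ K × K : f(x) Θ f(y)} of K is a bijection from the set of congruences of L onto the set of congruences of K. -/
universe u

/-- A lattice with least element is sectionally complemented if for all `a ≤ b`
there is `c` with `a ⊓ c = ⊥` and `a ⊔ c = b`. -/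
def SectionallyComplemented (L : Type*) [Lattice L] [OrderBot L] : Prop :=
  ∀ a b : L, a ≤ b → ∃ c : L, a ⊓ c = ⊥ ∧ a ⊔ c = b

/-- The desired properties of the extension `L ⊇ K` via the embedding `f`:
`L` is sectionally complemented, `f` is an injective lattice homomorphism, and
restriction along `f` is a bijection from the congruences of `L` onto those of `K`. -/
def CongrPreservingSecCompExt (K : Type u) [Lattice K] (L : Type u) [Lattice L]
    [OrderBot L] (f : K → L) : Prop :=
  SectionallyComplemented L ∧ Function.Injective f ∧
    (∀ x y : K, f (x ⊓ y) = f x ⊓ f y ∧ f (x ⊔ y) = f x ⊔ f y) ∧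
    -- the restriction of any congruence of `L` is a congruence of `K`
    (∀ Θ : L → L → Prop, IsLatCongr Θ → IsLatCongr (fun x y : K => Θ (f x) (f y))) ∧
    -- restriction is injective
    (∀ Θ₁ Θ₂ : L → L → Prop, IsLatCongr Θ₁ → IsLatCongr Θ₂ →
      (fun x y : K => Θ₁ (f x) (f y)) = (fun x y : K => Θ₂ (f x) (f y)) → Θ₁ = Θ₂) ∧
    -- restriction is surjective onto the congruences of `K`
    (∀ θ : K → K → Prop, IsLatCongr θ →
      ∃ Θ : L → L → Prop, IsLatCongr Θ ∧ ∀ x y : K, θ x y ↔ Θ (f x) (f y))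

namespace IsLatCongr

variable {L : Type*} [Lattice L] {r : L → L → Prop}

theorem refl (h : IsLatCongr r) (x : L) : r x x := h.1.refl x

theorem symm (h : IsLatCongr r) {x y : L} (hxy : r x y) : r y x := h.1.symm hxy

theorem trans (h : IsLatCongr r) {x y z : L} (hxy : r x y) (hyz : r y z) : r x z :=
  h.1.trans hxy hyz

theorem inf (h : IsLatCongr r) {x y u v : L} (hxy : r x y) (huv : r u v) :
    r (x ⊓ u) (y ⊓ v) := (h.2 x y u v hxy huv).1

theorem sup (h : IsLatCongr r) {x y u v : L} (hxy : r x y) (huv : r u v) :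
    r (x ⊔ u) (y ⊔ v) := (h.2 x y u v hxy huv).2

theorem inf_sup (h : IsLatCongr r) {x y : L} (hxy : r x y) : r (x ⊓ y) (x ⊔ y) := by
  have h1 : r (x ⊓ y) y := by simpa using h.inf hxy (h.refl y)
  have h2 : r (x ⊔ y) y := by simpa using h.sup hxy (h.refl y)
  exact h.trans h1 (h.symm h2)

/-- Congruence classes are convex. -/
theorem of_le (h : IsLatCongr r) {x y a b : L} (hxy : r x y) (hxa : x ≤ a) (hab : a ≤ b)
    (hby : b ≤ y) : r a b := by
  have h1 : r a y := by
    simpa [hxa, hab.trans hby] using h.sup hxy (h.refl a)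
  have h2 : r b y := by
    simpa [hxa.trans hab, hby] using h.sup hxy (h.refl b)
  exact h.trans h1 (h.symm h2)

theorem of_inf_sup (h : IsLatCongr r) {x y : L} (hxy : r (x ⊓ y) (x ⊔ y)) : r x y :=
  h.trans (h.symm (h.of_le hxy le_rfl inf_le_left le_sup_left))
    (h.of_le hxy le_rfl inf_le_right le_sup_right)

theorem of_bot_top [BoundedOrder L] (h : IsLatCongr r) (hr : r ⊥ ⊤) (x y : L) : r x y :=
  have key : ∀ z, r ⊥ z := fun _ => h.of_le hr le_rfl bot_le le_top
  h.trans (h.symm (key x)) (key y)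

theorem comap {K : Type*} [Lattice K] (h : IsLatCongr r) {f : K → L}
    (hf : ∀ x y, f (x ⊓ y) = f x ⊓ f y ∧ f (x ⊔ y) = f x ⊔ f y) :
    IsLatCongr fun x y => r (f x) (f y) := by
  refine ⟨⟨fun _ => h.refl _, fun hxy => h.symm hxy, fun hxy hyz => h.trans hxy hyz⟩, ?_⟩
  intro x y u v hxy huv
  simp only [hf]
  exact h.2 _ _ _ _ hxy huv

end IsLatCongr

/-- A lattice is simple if each of its congruences is equality or relates everything. -/
def CongrSimple (S : Type*) [Lattice S] : Prop :=
  ∀ r : S → S → Prop, IsLatCongr r → ∀ x y : S, x ≠ y → r x y → ∀ u v : S, r u v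

/-! ### Quotients of lattices by congruences -/

/-- The quotient of a lattice by a congruence. -/
def CongrQuot {K : Type*} [Lattice K] {r : K → K → Prop} (h : IsLatCongr r) : Type _ :=
  Quotient (Setoid.mk r h.1)

namespace CongrQuot

variable {K : Type*} [Lattice K] {r : K → K → Prop} (h : IsLatCongr r)

/-- The canonical projection onto the quotient. -/
def mk (x : K) : CongrQuot h := Quotient.mk (Setoid.mk r h.1) x

theorem mk_eq_mk {x y : K} : mk h x = mk h y ↔ r x y :=
  Quotient.eq (r := Setoid.mk r h.1)

theorem mk_surjective : Function.Surjective (mk h) := Quotient.mk_surjective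

instance : Max (CongrQuot h) :=
  ⟨Quotient.map₂ (· ⊔ ·) fun _ _ hxy _ _ huv => h.sup hxy huv⟩

instance : Min (CongrQuot h) :=
  ⟨Quotient.map₂ (· ⊓ ·) fun _ _ hxy _ _ huv => h.inf hxy huv⟩

theorem mk_sup (x y : K) : mk h (x ⊔ y) = mk h x ⊔ mk h y := rfl

theorem mk_inf (x y : K) : mk h (x ⊓ y) = mk h x ⊓ mk h y := rfl

instance : Lattice (CongrQuot h) :=
  Lattice.mk'
    (by
      intro a b
      obtain ⟨x, rfl⟩ := mk_surjective h a
      obtain ⟨y, rfl⟩ := mk_surjective h b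
      rw [← mk_sup, ← mk_sup, sup_comm])
    (by
      intro a b c
      obtain ⟨x, rfl⟩ := mk_surjective h a
      obtain ⟨y, rfl⟩ := mk_surjective h b
      obtain ⟨z, rfl⟩ := mk_surjective h c
      simp only [← mk_sup, sup_assoc])
    (by
      intro a b
      obtain ⟨x, rfl⟩ := mk_surjective h a
      obtain ⟨y, rfl⟩ := mk_surjective h b
      rw [← mk_inf, ← mk_inf, inf_comm])
    (by
      intro a b c
      obtain ⟨x, rfl⟩ := mk_surjective h a
      obtain ⟨y, rfl⟩ := mk_surjective h b
      obtain ⟨z, rfl⟩ := mk_surjective h c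
      simp only [← mk_inf, inf_assoc])
    (by
      intro a b
      obtain ⟨x, rfl⟩ := mk_surjective h a
      obtain ⟨y, rfl⟩ := mk_surjective h b
      rw [← mk_inf, ← mk_sup, sup_inf_self])
    (by
      intro a b
      obtain ⟨x, rfl⟩ := mk_surjective h a
      obtain ⟨y, rfl⟩ := mk_surjective h b
      rw [← mk_sup, ← mk_inf, inf_sup_self])

instance [Finite K] : Finite (CongrQuot h) := Finite.of_surjective _ (mk_surjective h)

end CongrQuot

/-! ### Simple sectionally complemented extensions -/

/-- The lattice `T` with a new least element and with three new atoms below each `t : T`;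
the only elements above an atom attached to `t` are the atom itself and the elements of `T`
above `t`. -/
inductive Spiked (T : Type*) : Type _
  | bot : Spiked T
  | atom (t : T) (k : Fin 3) : Spiked T
  | of (t : T) : Spiked T

namespace Spiked

variable {T : Type*}

instance [Finite T] : Finite (Spiked T) := by
  let g : Option ((T × Fin 3) ⊕ T) → Spiked T
    | none => bot
    | some (Sum.inl p) => atom p.1 p.2
    | some (Sum.inr t) => of t
  refine Finite.of_surjective g ?_
  rintro (_ | ⟨t, k⟩ | t)
  · exact ⟨none, rfl⟩
  · exact ⟨some (Sum.inl (t, k)), rfl⟩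
  · exact ⟨some (Sum.inr t), rfl⟩

variable [Lattice T]

/-- The order relation of `Spiked T`. -/
def Le : Spiked T → Spiked T → Prop
  | bot, _ => True
  | atom _ _, bot => False
  | atom s k, atom t l => s = t ∧ k = l
  | atom s _, of t => s ≤ t
  | of _, bot => False
  | of _, atom _ _ => False
  | of s, of t => s ≤ t

open Classical in
/-- The join operation of `Spiked T`. -/
noncomputable def join : Spiked T → Spiked T → Spiked T
  | bot, y => y
  | atom s k, bot => atom s k
  | atom s k, atom t l => if s = t ∧ k = l then atom s k else of (s ⊔ t)
  | atom s _, of t => of (s ⊔ t)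
  | of s, bot => of s
  | of s, atom t _ => of (s ⊔ t)
  | of s, of t => of (s ⊔ t)

open Classical in
/-- The meet operation of `Spiked T`. -/
noncomputable def meet : Spiked T → Spiked T → Spiked T
  | bot, _ => bot
  | atom _ _, bot => bot
  | atom s k, atom t l => if s = t ∧ k = l then atom s k else bot
  | atom s k, of t => if s ≤ t then atom s k else bot
  | of _, bot => bot
  | of s, atom t l => if t ≤ s then atom t l else bot
  | of s, of t => of (s ⊓ t)

noncomputable instance : Lattice (Spiked T) where
  le := Le
  le_refl := by rintro (_ | _ | _) <;> simp [Le]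
  le_trans := by
    rintro (_ | _ | _) (_ | _ | _) (_ | _ | _) <;> simp only [Le] <;> grind
  le_antisymm := by
    rintro (_ | _ | _) (_ | _ | _) <;> simp only [Le] <;> grind
  sup := join
  inf := meet
  le_sup_left := by
    rintro (_ | _ | _) (_ | _ | _) <;> simp only [join] <;> (try split_ifs) <;> simp [Le]
  le_sup_right := by
    rintro (_ | _ | _) (_ | _ | _) <;> simp only [join] <;> (try split_ifs) <;> simp_all [Le]
  sup_le := by
    rintro (_ | _ | _) (_ | _ | _) (_ | _ | _) <;> simp only [join] <;> (try split_ifs) <;>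
      simp_all [Le]
    all_goals grind
  inf_le_left := by
    rintro (_ | _ | _) (_ | _ | _) <;> simp only [meet] <;> (try split_ifs) <;> simp_all [Le]
  inf_le_right := by
    rintro (_ | _ | _) (_ | _ | _) <;> simp only [meet] <;> (try split_ifs) <;> simp_all [Le]
  le_inf := by
    rintro (_ | _ | _) (_ | _ | _) (_ | _ | _) <;> simp only [meet] <;> (try split_ifs) <;>
      simp_all [Le]
    grind

instance [OrderTop T] : BoundedOrder (Spiked T) where
  bot := bot
  bot_le _ := trivial
  top := of ⊤
  le_top := by rintro (_ | _ | _) <;> simp [LE.le, Le]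

theorem atom_sup_of (s t : T) (k : Fin 3) : atom s k ⊔ of t = of (s ⊔ t) := rfl

theorem atom_le_of {s t : T} {k : Fin 3} : atom s k ≤ of t ↔ s ≤ t := Iff.rfl

theorem atom_sup_atom {s t : T} {k l : Fin 3} (h : ¬(s = t ∧ k = l)) :
    atom s k ⊔ atom t l = of (s ⊔ t) := if_neg h

variable [OrderTop T]

theorem atom_inf_atom {s t : T} {k l : Fin 3} (h : ¬(s = t ∧ k = l)) :
    atom s k ⊓ atom t l = ⊥ := if_neg h

theorem of_inf_atom {s t : T} {k : Fin 3} (h : ¬t ≤ s) : of s ⊓ atom t k = ⊥ := if_neg h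

theorem sectionallyComplemented : SectionallyComplemented (Spiked T) := by
  intro a b hab
  rcases eq_or_ne a b with rfl | hne
  · exact ⟨⊥, by simp⟩
  rcases a with _ | ⟨s, k⟩ | s
  · exact ⟨b, bot_inf_eq _, bot_sup_eq _⟩
  · rcases b with _ | ⟨t, l⟩ | t
    · exact hab.elim
    · obtain ⟨rfl, rfl⟩ : s = t ∧ k = l := hab
      exact absurd rfl hne
    · have hk : ¬(s = t ∧ k = k + 1) := by
        rintro ⟨-, h⟩
        fin_cases k <;> simp at h
      refine ⟨atom t (k + 1), atom_inf_atom hk, ?_⟩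
      rw [atom_sup_atom hk, sup_eq_right.2 (atom_le_of.1 hab)]
  · rcases b with _ | ⟨t, l⟩ | t
    · exact hab.elim
    · exact hab.elim
    · have hst : s ≤ t := hab
      have hts : ¬t ≤ s := fun h => hne (congrArg of (le_antisymm hst h))
      refine ⟨atom t 0, of_inf_atom hts, ?_⟩
      rw [sup_comm, atom_sup_of, sup_eq_left.2 hst]

theorem exists_atom_le {c : Spiked T} (hc : c ≠ ⊥) : ∃ t k, atom t k ≤ c := by
  rcases c with _ | ⟨t, k⟩ | t
  · exact absurd rfl hc
  · exact ⟨t, k, le_rfl⟩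
  · exact ⟨t, 0, atom_le_of.2 le_rfl⟩

theorem congrSimple : CongrSimple (Spiked T) := by
  intro r h x y hne hxy
  obtain ⟨c, hc1, hc2⟩ := sectionallyComplemented (x ⊓ y) (x ⊔ y) inf_le_sup
  have hc : c ≠ ⊥ := by
    rintro rfl
    exact hne (inf_eq_sup.1 (by simpa using hc2))
  have hrc : r ⊥ c := by
    have := h.inf (h.inf_sup hxy) (h.refl c)
    rwa [hc1, inf_eq_right.2 (hc2 ▸ le_sup_right)] at this
  obtain ⟨t, k, htk⟩ := exists_atom_le hc
  have hra : r ⊥ (atom t k) := h.of_le hrc le_rfl bot_le htk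
  have key : ∀ l, k ≠ l → r (atom ⊤ l) ⊤ := by
    intro l hl
    have := h.sup hra (h.refl (atom ⊤ l))
    rw [bot_sup_eq, atom_sup_atom (fun h => hl h.2), sup_top_eq] at this
    exact this
  have h1 := key (k + 1) (by fin_cases k <;> simp)
  have h2 := key (k + 2) (by fin_cases k <;> simp)
  have h3 := h.inf h1 h2
  rw [atom_inf_atom (by rintro ⟨-, h⟩; fin_cases k <;> simp at h), inf_top_eq] at h3
  exact h.of_bot_top h3

theorem exists_ne_bot_ne_top : ∃ m : Spiked T, m ≠ ⊥ ∧ m ≠ ⊤ :=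
  ⟨atom ⊤ 0, fun h => (nomatch (show atom ⊤ 0 = bot from h)),
    fun h => (nomatch (show atom ⊤ 0 = of ⊤ from h))⟩

instance : Nontrivial (Spiked T) :=
  let ⟨m, hm, _⟩ := exists_ne_bot_ne_top (T := T)
  ⟨m, ⊥, hm⟩

end Spiked

/-! ### Stable products -/

/-- An element of a product indexed by an ordered set is stable if below each index where it is
`⊤` it takes only the values `⊥` and `⊤`. -/
def IsStable {J : Type*} [PartialOrder J] {S : J → Type*} [∀ i, Lattice (S i)]
    [∀ i, BoundedOrder (S i)] (x : ∀ i, S i) : Prop :=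
  ∀ ⦃i j : J⦄, j < i → x i = ⊤ → x j = ⊥ ∨ x j = ⊤

/-- The stable elements of a product of bounded lattices. -/
abbrev StableProd {J : Type*} [PartialOrder J] (S : J → Type*) [∀ i, Lattice (S i)]
    [∀ i, BoundedOrder (S i)] : Type _ :=
  {x : ∀ i, S i // IsStable x}

namespace StableProd

variable {J : Type*} [PartialOrder J] {S : J → Type*} [∀ i, Lattice (S i)]
  [∀ i, BoundedOrder (S i)]

open Classical in
/-- The least stable element above a given element of the product. -/
noncomputable def stabilize (x : ∀ i, S i) : ∀ i, S i := fun j =>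
  if (∃ i, j < i ∧ x i = ⊤) ∧ x j ≠ ⊥ then ⊤ else x j

theorem le_stabilize (x : ∀ i, S i) : x ≤ stabilize x := by
  intro j
  unfold stabilize
  split_ifs
  · exact le_top
  · exact le_rfl

theorem isStable_stabilize (x : ∀ i, S i) : IsStable (stabilize x) := by
  intro i j hji hi
  have hk : ∃ k, j < k ∧ x k = ⊤ := by
    unfold stabilize at hi
    split_ifs at hi with h
    · obtain ⟨⟨k, hik, hk⟩, -⟩ := h
      exact ⟨k, hji.trans hik, hk⟩
    · exact ⟨i, hji, hi⟩
  by_cases hj : x j = ⊥ <;> simp [stabilize, hk, hj]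

theorem stabilize_le {x z : ∀ i, S i} (hxz : x ≤ z) (hz : IsStable z) : stabilize x ≤ z := by
  intro j
  unfold stabilize
  split_ifs with h
  · obtain ⟨⟨i, hji, hi⟩, hj⟩ := h
    rcases hz hji (top_le_iff.1 (hi ▸ hxz i)) with h0 | h1
    · exact absurd (le_bot_iff.1 (h0 ▸ hxz j)) hj
    · exact h1.ge
  · exact hxz j

theorem stabilize_congr {U : Set J} (hU : IsUpperSet U) {x y : ∀ i, S i}
    (h : ∀ i ∈ U, x i = y i) {j : J} (hj : j ∈ U) : stabilize x j = stabilize y j := by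
  classical
  have : (∃ i, j < i ∧ x i = ⊤) ↔ ∃ i, j < i ∧ y i = ⊤ :=
    exists_congr fun i => and_congr_right fun hji => by rw [h i (hU hji.le hj)]
  exact if_congr (and_congr this (by rw [h j hj])) rfl (h j hj)

theorem stabilize_eq_top {x : ∀ i, S i} {i j : J} (hji : j < i) (hi : x i = ⊤) (hj : x j ≠ ⊥) :
    stabilize x j = ⊤ :=
  if_pos ⟨⟨i, hji, hi⟩, hj⟩

theorem stabilize_of_isStable {x : ∀ i, S i} (hx : IsStable x) : stabilize x = x :=
  le_antisymm (stabilize_le le_rfl hx) (le_stabilize x)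

theorem isStable_inf {x y : ∀ i, S i} (hx : IsStable x) (hy : IsStable y) :
    IsStable (x ⊓ y) := by
  intro i j hji hi
  obtain ⟨h1, h2⟩ := inf_eq_top_iff.1 (show x i ⊓ y i = ⊤ from hi)
  rcases hx hji h1 with h | h <;> rcases hy hji h2 with h' | h' <;> simp [h, h']

noncomputable instance : Lattice (StableProd S) where
  sup x y := ⟨stabilize (x.1 ⊔ y.1), isStable_stabilize _⟩
  inf x y := ⟨x.1 ⊓ y.1, isStable_inf x.2 y.2⟩
  le_sup_left x y := le_sup_left.trans (le_stabilize (x.1 ⊔ y.1))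
  le_sup_right x y := le_sup_right.trans (le_stabilize (x.1 ⊔ y.1))
  sup_le _ _ z hx hy := stabilize_le (sup_le hx hy) z.2
  inf_le_left x y := inf_le_left (a := x.1) (b := y.1)
  inf_le_right x y := inf_le_right (a := x.1) (b := y.1)
  le_inf _ _ _ hy hz := le_inf (α := ∀ i, S i) hy hz

instance : OrderBot (StableProd S) where
  bot := ⟨⊥, fun _ _ _ _ => Or.inl rfl⟩
  bot_le x := bot_le (a := x.1)

theorem ext {x y : StableProd S} (h : ∀ i, x.1 i = y.1 i) : x = y := Subtype.ext (funext h)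

theorem coe_sup (x y : StableProd S) : (x ⊔ y).1 = stabilize (x.1 ⊔ y.1) := rfl

theorem inf_apply (x y : StableProd S) (i : J) : (x ⊓ y).1 i = x.1 i ⊓ y.1 i := rfl

theorem bot_apply (i : J) : (⊥ : StableProd S).1 i = ⊥ := rfl

/-- Agreement on an upper set of coordinates is a congruence. -/
theorem isLatCongr_eqOn {U : Set J} (hU : IsUpperSet U) :
    IsLatCongr fun x y : StableProd S => ∀ i ∈ U, x.1 i = y.1 i := by
  refine ⟨⟨fun _ _ _ => rfl, fun h i hi => (h i hi).symm,
    fun h h' i hi => (h i hi).trans (h' i hi)⟩, fun x y u v hxy huv => ⟨fun i hi => ?_, ?_⟩⟩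
  · rw [inf_apply, inf_apply, hxy i hi, huv i hi]
  · intro i hi
    refine stabilize_congr hU (fun j hj => ?_) hi
    rw [Pi.sup_apply, Pi.sup_apply, hxy j hj, huv j hj]

theorem sectionallyComplemented [Finite J] (hS : ∀ i, SectionallyComplemented (S i)) :
    SectionallyComplemented (StableProd S) := by
  classical
  intro a b hab
  choose c hc1 hc2 using fun i => hS i (a.1 i) (b.1 i) (hab i)
  let d : ∀ i, S i := fun j =>
    if ∃ i, j < i ∧ b.1 i = ⊤ then (if a.1 j = ⊥ then b.1 j else ⊥) else c j
  have hdb : d ≤ b.1 := by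
    intro j
    simp only [d]
    split_ifs
    · exact le_rfl
    · exact bot_le
    · exact hc2 j ▸ le_sup_right
  have hd : IsStable d := by
    intro i j hji hi
    have hbi : b.1 i = ⊤ := top_le_iff.1 (hi ▸ hdb i)
    have hj : ∃ i, j < i ∧ b.1 i = ⊤ := ⟨i, hji, hbi⟩
    simp only [d, hj, if_true]
    split_ifs
    · exact b.2 hji hbi
    · exact Or.inl rfl
  refine ⟨⟨d, hd⟩, ext fun j => ?_, le_antisymm (sup_le hab hdb) fun j => ?_⟩
  · simp only [inf_apply, bot_apply, d]
    split_ifs with h h'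
    · simp [h']
    · simp
    · exact hc1 j
  · rw [coe_sup]
    by_cases h : ∃ i, j < i ∧ b.1 i = ⊤
    · by_cases h' : a.1 j = ⊥
      · refine le_trans ?_ (le_stabilize _ j)
        simp [d, h, h']
      · obtain ⟨i, hji, hi⟩ := h
        obtain ⟨m, him, hm⟩ := (Set.toFinite {i | b.1 i = ⊤}).exists_le_maximal hi
        have hm' : ¬∃ i, m < i ∧ b.1 i = ⊤ := fun ⟨k, hmk, hk⟩ => hm.not_gt hk hmk
        rw [stabilize_eq_top (hji.trans_le him)]
        · exact le_top
        · rw [Pi.sup_apply]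
          simp only [d, hm', if_false]
          exact (hc2 m).trans hm.prop
        · exact fun h0 => h' (sup_eq_bot_iff.1 h0).1
    · refine le_trans ?_ (le_stabilize _ j)
      simp [d, h, hc2]

section Congruences

variable [∀ i, Nontrivial (S i)]

open Classical in
/-- The element of the stable product with value `s` at `i` and `⊥` elsewhere. -/
noncomputable def single (i : J) (s : S i) : StableProd S :=
  ⟨Function.update ⊥ i s, by
    intro k j hjk hk
    rcases eq_or_ne k i with rfl | hki
    · exact Or.inl (by simp [hjk.ne])
    · simp [hki] at hk⟩

theorem single_same (i : J) (s : S i) : (single i s).1 i = s := by simp [single]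

theorem single_of_ne {i j : J} (h : j ≠ i) (s : S i) : (single i s).1 j = ⊥ := by
  simp [single, h]

theorem single_bot (i : J) : single i (⊥ : S i) = ⊥ :=
  ext fun j => by
    rcases eq_or_ne j i with rfl | h
    · rw [single_same, bot_apply]
    · rw [single_of_ne h, bot_apply]

theorem inf_single_top (x : StableProd S) (i : J) : x ⊓ single i ⊤ = single i (x.1 i) :=
  ext fun j => by
    rcases eq_or_ne j i with rfl | h
    · simp [inf_apply, single_same]
    · simp [inf_apply, single_of_ne h]

theorem single_inf (i : J) (s t : S i) : single i (s ⊓ t) = single i s ⊓ single i t :=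
  ext fun j => by
    rcases eq_or_ne j i with rfl | h
    · simp [inf_apply, single_same]
    · simp [inf_apply, single_of_ne h]

theorem single_sup (i : J) (s t : S i) : single i (s ⊔ t) = single i s ⊔ single i t := by
  have : (single i s).1 ⊔ (single i t).1 = (single i (s ⊔ t)).1 := by
    funext j
    rcases eq_or_ne j i with rfl | h
    · simp [single_same]
    · simp [single_of_ne h]
  refine Subtype.ext ?_
  rw [coe_sup, this, stabilize_of_isStable (single i (s ⊔ t)).2]

/-- Each congruence of a finite stable product of simple lattices is agreement on an upper set
of coordinates. -/
theorem exists_isUpperSet_forall_iff [Finite J] (hS : ∀ i, CongrSimple (S i))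
    (hm : ∀ i, ∃ m : S i, m ≠ ⊥ ∧ m ≠ ⊤) {r : StableProd S → StableProd S → Prop}
    (h : IsLatCongr r) :
    ∃ U : Set J, IsUpperSet U ∧ ∀ x y, r x y ↔ ∀ i ∈ U, x.1 i = y.1 i := by
  classical
  have := Fintype.ofFinite J
  have hsingle : ∀ i (s t : S i), s ≠ t → r (single i s) (single i t) →
      r ⊥ (single i ⊤) := by
    intro i s t hst hr
    rw [← single_bot i]
    exact hS i _ (h.comap fun s t => ⟨single_inf i s t, single_sup i s t⟩) s t hst hr ⊥ ⊤
  refine ⟨{i | ¬r ⊥ (single i ⊤)}, ?_, fun x y => ⟨fun hxy i hi => ?_, fun hxy => ?_⟩⟩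
  · intro j i hji hj hi
    rcases hji.eq_or_lt with rfl | hji
    · exact hj hi
    obtain ⟨m, hm0, hm1⟩ := hm j
    refine hj (hsingle j m ⊤ hm1 ?_)
    have h1 := h.inf (h.sup (h.refl (single j m)) hi) (h.refl (single j ⊤))
    rw [sup_bot_eq, inf_single_top, inf_single_top, single_same, coe_sup,
      stabilize_eq_top hji] at h1
    · exact h1
    · rw [Pi.sup_apply, single_same, sup_top_eq]
    · rw [Pi.sup_apply, single_same, single_of_ne hji.ne, sup_bot_eq]
      exact hm0
  · by_contra hne
    refine hi (hsingle i _ _ hne ?_)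
    rw [← inf_single_top, ← inf_single_top]
    exact h.inf hxy (h.refl _)
  · let D : Finset J := {i | r ⊥ (single i ⊤)}
    let e : StableProd S := D.sup fun i => single i ⊤
    have he : r ⊥ e := by
      refine Finset.sup_induction (h.refl ⊥) (fun a ha b hb => ?_) fun i hi => ?_
      · simpa using h.sup ha hb
      · simpa [D] using hi
    have hei : ∀ i ∈ D, e.1 i = ⊤ := by
      intro i hi
      have h1 : single i ⊤ ≤ e := Finset.le_sup (f := fun i => single i (⊤ : S i)) hi
      exact top_le_iff.1 (single_same i (⊤ : S i) ▸ h1 i)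
    have hxe : x ⊔ e = y ⊔ e := by
      refine Subtype.ext (congrArg stabilize (funext fun i => ?_))
      rw [Pi.sup_apply, Pi.sup_apply]
      by_cases hi : i ∈ D
      · rw [hei i hi, sup_top_eq, sup_top_eq]
      · rw [hxy i (by simpa [D] using hi)]
    have hx := h.sup (h.refl x) he
    have hy := h.sup (h.refl y) he
    rw [sup_bot_eq] at hx hy
    exact h.trans hx (hxe ▸ h.symm hy)

end Congruences

end StableProd

/-! ### Congruences maximal with respect to separating a covering pair -/

section CoverCongr

variable {K : Type*} [Lattice K]

/-- `r` is the largest congruence that does not relate `a` and `b`. -/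
def IsLargestSeparating (r : K → K → Prop) (a b : K) : Prop :=
  IsLatCongr r ∧ ¬r a b ∧ ∀ s : K → K → Prop, IsLatCongr s → ¬s a b → s ≤ r

theorem exists_isLargestSeparating {a b : K} (hab : a ⋖ b) :
    ∃ r : K → K → Prop, IsLargestSeparating r a b := by
  let p : K → K → Prop := fun x y => ∃ s : K → K → Prop, IsLatCongr s ∧ ¬s a b ∧ s x y
  have hinf : ∀ z x y, Relation.TransGen p x y → Relation.TransGen p (x ⊓ z) (y ⊓ z) :=
    fun z _ _ hxy => hxy.lift (· ⊓ z)
      fun _ _ ⟨s, hs, hsab, hsxy⟩ => ⟨s, hs, hsab, hs.inf hsxy (hs.refl z)⟩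
  have hsup : ∀ z x y, Relation.TransGen p x y → Relation.TransGen p (x ⊔ z) (y ⊔ z) :=
    fun z _ _ hxy => hxy.lift (· ⊔ z)
      fun _ _ ⟨s, hs, hsab, hsxy⟩ => ⟨s, hs, hsab, hs.sup hsxy (hs.refl z)⟩
  have hsymm : ∀ x y, p x y → p y x :=
    fun _ _ ⟨s, hs, hsab, hsxy⟩ => ⟨s, hs, hsab, hs.symm hsxy⟩
  have heq : IsLatCongr fun x y : K => x = y :=
    ⟨⟨fun _ => rfl, Eq.symm, Eq.trans⟩, by rintro x _ u _ rfl rfl; exact ⟨rfl, rfl⟩⟩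
  have hproj : ∀ x, (x ⊓ b) ⊔ a = a ∨ (x ⊓ b) ⊔ a = b := fun x =>
    hab.eq_or_eq le_sup_right (sup_le inf_le_right hab.le)
  have hfix : ∀ x y, Relation.TransGen p x y → (x ⊓ b) ⊔ a = (y ⊓ b) ⊔ a := by
    have hstep : ∀ x y, p x y → (x ⊓ b) ⊔ a = (y ⊓ b) ⊔ a := by
      rintro x y ⟨s, hs, hsab, hsxy⟩
      have h1 := hs.sup (hs.inf hsxy (hs.refl b)) (hs.refl a)
      rcases hproj x with hx | hx <;> rcases hproj y with hy | hy <;> rw [hx, hy] at h1 ⊢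
      · exact absurd h1 hsab
      · exact absurd (hs.symm h1) hsab
    intro x y hxy
    induction hxy with
    | single h => exact hstep _ _ h
    | tail _ h ih => exact ih.trans (hstep _ _ h)
  refine ⟨Relation.TransGen p, ⟨⟨fun x => .single ⟨_, heq, hab.ne, rfl⟩, fun hxy => ?_,
    fun hxy hyz => hxy.trans hyz⟩, fun x y u v hxy huv => ⟨?_, ?_⟩⟩, fun h => ?_,
    fun s hs hsab x y hxy => .single ⟨s, hs, hsab, hxy⟩⟩
  · exact (Relation.transGen_swap (r := p)).1 (Relation.TransGen.mono (fun x y => hsymm x y) _ _ hxy)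
  · refine (hinf u x y hxy).trans ?_
    simpa only [inf_comm y] using hinf y u v huv
  · refine (hsup u x y hxy).trans ?_
    simpa only [sup_comm y] using hsup y u v huv
  · have := hfix a b h
    simp [hab.le] at this
    exact hab.ne this

/-- A congruence that does not relate `x` and `y` fails to relate some covering pair in the
interval between their meet and their join. -/
theorem IsLatCongr.exists_covBy [Finite K] {r : K → K → Prop} (h : IsLatCongr r) {x y : K}
    (hxy : ¬r x y) : ∃ a b, x ⊓ y ≤ a ∧ a ⋖ b ∧ b ≤ x ⊔ y ∧ ¬r a b := by
  obtain ⟨a, hxa, ha⟩ := (Set.toFinite {a | a ≤ x ⊔ y ∧ r (x ⊓ y) a}).exists_le_maximal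
    (show x ⊓ y ∈ {a | a ≤ x ⊔ y ∧ r (x ⊓ y) a} from ⟨inf_le_sup, h.refl _⟩)
  have hne : a ≠ x ⊔ y := by
    rintro rfl
    exact hxy (h.of_inf_sup ha.prop.2)
  obtain ⟨b, hab, hb⟩ := exists_covBy_le_of_lt (lt_of_le_of_ne ha.prop.1 hne)
  exact ⟨a, b, hxa, hab, hb, fun hr => ha.not_gt ⟨hb, h.trans ha.prop.2 hr⟩ hab.lt⟩

variable (K) in
/-- The congruences of `K` that are largest among those separating some covering pair. -/
def CoverCongr : Type _ :=
  {r : K → K → Prop // ∃ a b, a ⋖ b ∧ IsLargestSeparating r a b}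

namespace CoverCongr

instance : PartialOrder (CoverCongr K) := inferInstanceAs (PartialOrder {_r // _})

instance [Finite K] : Finite (CoverCongr K) := inferInstanceAs (Finite {_r // _})

theorem isLatCongr (i : CoverCongr K) : IsLatCongr i.1 :=
  let ⟨_, _, _, h⟩ := i.2
  h.1

/-- Every congruence is an intersection of an upper set of elements of `CoverCongr K`. -/
theorem iff_forall_le [Finite K] {r : K → K → Prop} (h : IsLatCongr r) (x y : K) :
    r x y ↔ ∀ i : CoverCongr K, r ≤ i.1 → i.1 x y := by
  refine ⟨fun hxy i hi => hi x y hxy, fun hxy => ?_⟩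
  by_contra hne
  obtain ⟨a, b, hxa, hab, hby, hr⟩ := h.exists_covBy hne
  obtain ⟨s, hs⟩ := exists_isLargestSeparating hab
  have hsxy : s x y := hxy ⟨s, a, b, hab, hs⟩ (hs.2.2 r h hr)
  exact hs.2.1 (hs.1.of_le (hs.1.inf_sup hsxy) hxa hab.le hby)

/-- An upper set of elements of `CoverCongr K` is determined by its intersection. -/
theorem mem_of_forall_imp {U : Set (CoverCongr K)} (hU : IsUpperSet U) {i : CoverCongr K}
    (h : ∀ x y, (∀ j ∈ U, j.1 x y) → i.1 x y) : i ∈ U := by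
  obtain ⟨a, b, -, hi⟩ := i.2
  by_contra hiU
  refine hi.2.1 (h a b fun j hj => ?_)
  by_contra hjab
  exact hiU (hU (show j ≤ i from hi.2.2 j.1 j.isLatCongr hjab) hj)

/-- A simple extension of the quotient of `K` by the congruence `i`. -/
abbrev Factor (i : CoverCongr K) : Type _ := Spiked (WithTop (CongrQuot i.isLatCongr))

/-- The canonical map from `K` into the simple extension of its quotient by `i`. -/
def toFactor (i : CoverCongr K) (x : K) : i.Factor :=
  Spiked.of (CongrQuot.mk i.isLatCongr x : WithTop (CongrQuot i.isLatCongr))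

theorem toFactor_eq_iff (i : CoverCongr K) {x y : K} :
    i.toFactor x = i.toFactor y ↔ i.1 x y := by
  rw [toFactor, toFactor, Spiked.of.injEq, WithTop.coe_inj, CongrQuot.mk_eq_mk]

theorem toFactor_ne_top (i : CoverCongr K) (x : K) : i.toFactor x ≠ ⊤ := fun h =>
  WithTop.coe_ne_top (Spiked.of.inj h)

/-- The diagonal embedding of `K` into the stable product of the simple extensions. -/
def embed (x : K) : StableProd (Factor (K := K)) :=
  ⟨fun i => i.toFactor x, fun i _ _ hi => absurd hi (i.toFactor_ne_top x)⟩

theorem embed_inf (x y : K) : embed (x ⊓ y) = embed x ⊓ embed y := rfl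

theorem embed_sup (x y : K) : embed (x ⊔ y) = embed x ⊔ embed y := by
  have : (embed x).1 ⊔ (embed y).1 = (embed (x ⊔ y)).1 := rfl
  refine Subtype.ext ?_
  rw [StableProd.coe_sup, this, StableProd.stabilize_of_isStable (embed (x ⊔ y)).2]

theorem embed_injective [Finite K] : Function.Injective (embed (K := K)) := by
  intro x y hxy
  have heq : IsLatCongr fun x y : K => x = y :=
    ⟨⟨fun _ => rfl, Eq.symm, Eq.trans⟩, by rintro x _ u _ rfl rfl; exact ⟨rfl, rfl⟩⟩
  refine (iff_forall_le heq x y).2 fun i _ => i.toFactor_eq_iff.1 ?_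
  exact congrFun (congrArg Subtype.val hxy) i

end CoverCongr

end CoverCongr

/-- **Grätzer–Schmidt**: every finite lattice `K` has a finite, sectionally
complemented, congruence-preserving extension `L`. -/
theorem sectionally_complemented_congruence_preserving_extension
    (K : Type u) [Lattice K] [Fintype K] :
    ∃ (L : Type u) (instL : Lattice L)
      (instB : @OrderBot L (@Lattice.toSemilatticeInf L instL).toPartialOrder.toPreorder.toLE)
      (_ : Fintype L) (f : K → L),
      @CongrPreservingSecCompExt K _ L instL instB f := by
  classical
  have hext : CongrPreservingSecCompExt K (StableProd (CoverCongr.Factor (K := K)))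
      CoverCongr.embed := by
    have hhom : ∀ x y : K, CoverCongr.embed (x ⊓ y) = CoverCongr.embed x ⊓ CoverCongr.embed y ∧
        CoverCongr.embed (x ⊔ y) = CoverCongr.embed x ⊔ CoverCongr.embed y :=
      fun x y => ⟨CoverCongr.embed_inf x y, CoverCongr.embed_sup x y⟩
    have hclass := fun (r : StableProd (CoverCongr.Factor (K := K)) → _ → Prop)
        (h : IsLatCongr r) => StableProd.exists_isUpperSet_forall_iff
      (fun _ => Spiked.congrSimple) (fun _ => Spiked.exists_ne_bot_ne_top) h
    refine ⟨StableProd.sectionallyComplemented fun _ => Spiked.sectionallyComplemented,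
      CoverCongr.embed_injective, hhom, fun r h => h.comap hhom, fun r₁ r₂ h₁ h₂ heq => ?_,
      fun r h => ?_⟩
    · obtain ⟨U₁, hU₁, hr₁⟩ := hclass r₁ h₁
      obtain ⟨U₂, hU₂, hr₂⟩ := hclass r₂ h₂
      have hiff : ∀ x y : K, (∀ i ∈ U₁, i.1 x y) ↔ ∀ i ∈ U₂, i.1 x y := by
        intro x y
        have := iff_of_eq (congrFun (congrFun heq x) y)
        rw [hr₁, hr₂] at this
        simpa only [CoverCongr.embed, CoverCongr.toFactor_eq_iff] using this
      have hU : U₁ = U₂ := Set.Subset.antisymm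
        (fun i hi => CoverCongr.mem_of_forall_imp hU₂ fun x y h => (hiff x y).2 h i hi)
        (fun i hi => CoverCongr.mem_of_forall_imp hU₁ fun x y h => (hiff x y).1 h i hi)
      funext x y
      exact propext (by rw [hr₁, hr₂, hU])
    · have hU : IsUpperSet {i : CoverCongr K | r ≤ i.1} := fun _ _ hij hi x y hxy =>
        hij x y (hi x y hxy)
      refine ⟨_, StableProd.isLatCongr_eqOn hU, fun x y => ?_⟩
      rw [CoverCongr.iff_forall_le h]
      simp only [CoverCongr.embed, CoverCongr.toFactor_eq_iff, Set.mem_ofPred_eq]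
  exact ⟨_, _, _, Fintype.ofFinite _, _, hext⟩
end

section
/- A reflexive binary relation α on a lattice L is a congruence if and only if the following three conditions hold for all x, y, z, t ∈ L: (i) x α y if and only if (x ⊓ y) α (x ⊔ y); (ii) if x ≤ y ≤ z, x α y, and y α z, then x α z; (iii) if x ≤ y and x α y, then (x ⊓ t) α (y ⊓ t) and (x ⊔ t) α (y ⊔ t) (the Technical Lemma). -/
/-- **The Technical Lemma** (Grätzer–Schmidt, Maeda): a reflexive binary relation `α`
on a lattice `L` is a congruence iff
(i) `x α y ↔ (x ⊓ y) α (x ⊔ y)`;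
(ii) `x ≤ y ≤ z`, `x α y`, `y α z` imply `x α z`;
(iii) `x ≤ y` and `x α y` imply `(x ⊓ t) α (y ⊓ t)` and `(x ⊔ t) α (y ⊔ t)`. -/
theorem technical_lemma {L : Type*} [Lattice L] (α : L → L → Prop)
    (hrefl : ∀ x : L, α x x) :
    IsLatCongr α ↔
      ((∀ x y : L, α x y ↔ α (x ⊓ y) (x ⊔ y)) ∧
       (∀ x y z : L, x ≤ y → y ≤ z → α x y → α y z → α x z) ∧
       (∀ x y t : L, x ≤ y → α x y → α (x ⊓ t) (y ⊓ t) ∧ α (x ⊔ t) (y ⊔ t))) := by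
  constructor
  · rintro ⟨heq, hcompat⟩
    let c : LatticeCon L :=
      { r := α
        iseqv := heq
        inf := fun h k => (hcompat _ _ _ _ h k).1
        sup := fun h k => (hcompat _ _ _ _ h k).2 }
    exact ⟨fun _ _ => c.r_inf_sup_iff.symm, fun _ _ _ _ _ => heq.trans,
      fun x y t _ h => hcompat x y t t h (hrefl t)⟩
  · rintro ⟨hinterval, htrans, hcompat⟩
    have : Std.Refl α := ⟨hrefl⟩
    let c : LatticeCon L := LatticeCon.mk' α hinterval htrans hcompat
    exact ⟨c.iseqv, fun _ _ _ _ h k => ⟨c.inf h k, c.sup h k⟩⟩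
end

section
/- Let L be a finite lattice and let α be an equivalence relation on L each of whose equivalence classes is an interval, i.e., of the form {x : a ≤ x ≤ b} for some a ≤ b. Then α is a congruence of L if and only if the following condition and its dual hold: whenever x is covered by y (x ⋖ y) and x α y, then for every z ∈ L one has (x ⊔ z) α (y ⊔ z); dually, whenever x ⋖ y and x α y, then for every z ∈ L one has (x ⊓ z) α (y ⊓ z) (the Technical Lemma for Finite Lattices). -/
/-- On a finite order, a map that sends related covering pairs to related pairs sends all related
comparable pairs to related pairs, provided the relation is an equivalence with convex classes. -/
theorem rel_map_of_le_of_covBy {L : Type*} [PartialOrder L] [Finite L] {r : L → L → Prop}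
    (hr : Equivalence r) (hconv : ∀ ⦃x y w : L⦄, r x y → x ≤ w → w ≤ y → r x w)
    {f : L → L} (hf : ∀ x y : L, x ⋖ y → r x y → r (f x) (f y))
    {x y : L} (hxy : x ≤ y) (h : r x y) : r (f x) (f y) := by
  induction x using WellFoundedGT.induction with
  | ind x ih =>
    rcases hxy.eq_or_lt with rfl | hlt
    · exact hr.refl _
    · obtain ⟨w, hxw, hwy⟩ := exists_covBy_le_of_lt hlt
      have hw : r x w := hconv h hxw.le hwy
      exact hr.trans (hf x w hxw hw) (ih w hxw.lt hwy (hr.trans (hr.symm hw) h))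

/-- **The Technical Lemma for Finite Lattices**: let `L` be a finite lattice and `α`
an equivalence relation on `L` all of whose classes are intervals. Then `α` is a
congruence iff whenever `x ⋖ y` and `x α y`, then `(x ⊔ z) α (y ⊔ z)` for all `z`,
and dually `(x ⊓ z) α (y ⊓ z)` for all `z`. -/
theorem technical_lemma_finite {L : Type*} [Lattice L] [Fintype L]
    (α : L → L → Prop) (heqv : Equivalence α)
    (hintervals : ∀ c : L, ∃ a b : L, a ≤ b ∧ ∀ x : L, α c x ↔ (a ≤ x ∧ x ≤ b)) :
    IsLatCongr α ↔
      ((∀ x y z : L, x ⋖ y → α x y → α (x ⊔ z) (y ⊔ z)) ∧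
       (∀ x y z : L, x ⋖ y → α x y → α (x ⊓ z) (y ⊓ z))) := by
  constructor
  · rintro ⟨-, h⟩
    exact ⟨fun x y z _ hxy => (h x y z z hxy (heqv.refl z)).2,
      fun x y z _ hxy => (h x y z z hxy (heqv.refl z)).1⟩
  · rintro ⟨hsup, hinf⟩
    have hconv : ∀ ⦃x y w : L⦄, α x y → x ≤ w → w ≤ y → α x w := by
      intro x y w hxy hxw hwy
      obtain ⟨a, b, -, hab⟩ := hintervals x
      exact (hab w).2 ⟨((hab x).1 (heqv.refl x)).1.trans hxw, hwy.trans ((hab y).1 hxy).2⟩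
    have hjoin : ∀ ⦃x y : L⦄, α x y → α x (x ⊔ y) := by
      intro x y hxy
      obtain ⟨a, b, -, hab⟩ := hintervals x
      have hx := (hab x).1 (heqv.refl x)
      exact (hab _).2 ⟨hx.1.trans le_sup_left, sup_le hx.2 ((hab y).1 hxy).2⟩
    have hmap : ∀ f : L → L, (∀ x y : L, x ⋖ y → α x y → α (f x) (f y)) →
        ∀ x y : L, α x y → α (f x) (f y) := by
      intro f hf x y hxy
      have hx := hjoin hxy
      have hy := heqv.trans (heqv.symm hxy) hx
      exact heqv.trans (rel_map_of_le_of_covBy heqv hconv hf le_sup_left hx)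
        (heqv.symm (rel_map_of_le_of_covBy heqv hconv hf le_sup_right hy))
    refine ⟨heqv, fun x y u v hxy huv => ⟨?_, ?_⟩⟩
    · have h := hmap (· ⊓ y) (fun a b => hinf a b y) u v huv
      rw [inf_comm u, inf_comm v] at h
      exact heqv.trans (hmap (· ⊓ u) (fun a b => hinf a b u) x y hxy) h
    · have h := hmap (· ⊔ y) (fun a b => hsup a b y) u v huv
      rw [sup_comm u, sup_comm v] at h
      exact heqv.trans (hmap (· ⊔ u) (fun a b => hsup a b u) x y hxy) h
end

section
/- Every finite subdirectly irreducible lattice can be embedded into a simple lattice with at most two extra elements: if L is a finite lattice with at least two elements for which there exist u < v such that the pair (u, v) belongs to every congruence of L other than the equality relation, then there exist a finite simple lattice M with |M| ≤ |L| + 2 and an injective lattice homomorphism of L into M. -/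
universe u

/-- A lattice is simple if it has at least two elements and its only congruences are
the equality relation and the total relation. -/
def IsSimpleLattice (M : Type*) [Lattice M] : Prop :=
  (∃ a b : M, a ≠ b) ∧
    ∀ r : M → M → Prop, IsLatCongr r →
      r = (fun x y : M => x = y) ∨ r = (fun _ _ : M => True)

/-- A lattice homomorphism. -/
def IsLatHom {K M : Type*} [Lattice K] [Lattice M] (f : K → M) : Prop :=
  ∀ x y : K, f (x ⊓ y) = f x ⊓ f y ∧ f (x ⊔ y) = f x ⊔ f y

/-- The lattice `L` with one further element `new`, intended to lie above exactly the elements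
below `u` and below nothing but the top element of `L`. -/
inductive AdjoinAbove {L : Type u} (u : L) : Type u
  | of : L → AdjoinAbove u
  | new : AdjoinAbove u

namespace AdjoinAbove

variable {L : Type u}

/-- `AdjoinAbove u` is `L` with one extra point. -/
def equivOption (u : L) : Option L ≃ AdjoinAbove u where
  toFun o := o.elim new of
  invFun x := match x with
    | of y => some y
    | new => none
  left_inv o := by cases o <;> rfl
  right_inv x := by cases x <;> rfl

variable [Lattice L] [BoundedOrder L] {u : L}

/-- The order of `AdjoinAbove u`. -/
def Le : AdjoinAbove u → AdjoinAbove u → Prop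
  | of x, of y => x ≤ y
  | of x, new => x ≤ u
  | new, of y => y = ⊤
  | new, new => True

open Classical in
/-- The join of `AdjoinAbove u`. -/
noncomputable def join : AdjoinAbove u → AdjoinAbove u → AdjoinAbove u
  | of x, of y => of (x ⊔ y)
  | of x, new => if x ≤ u then new else of ⊤
  | new, of y => if y ≤ u then new else of ⊤
  | new, new => new

open Classical in
/-- The meet of `AdjoinAbove u`. -/
noncomputable def meet : AdjoinAbove u → AdjoinAbove u → AdjoinAbove u
  | of x, of y => of (x ⊓ y)
  | of x, new => if x = ⊤ then new else of (x ⊓ u)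
  | new, of y => if y = ⊤ then new else of (y ⊓ u)
  | new, new => new

/-- The lattice structure of `AdjoinAbove u`. -/
noncomputable abbrev lattice (hu : u ≠ ⊤) : Lattice (AdjoinAbove u) where
  le := Le
  sup := join
  inf := meet
  le_refl x := by cases x <;> simp [Le]
  le_trans x y z hxy hyz := by
    rcases x with x | _ <;> rcases y with y | _ <;> rcases z with z | _ <;> simp only [Le] at *
    · exact hxy.trans hyz
    · exact hxy.trans hyz
    · exact hyz.symm ▸ le_top
    · exact hxy
    · exact top_le_iff.1 (hxy ▸ hyz)
    · exact hyz
  le_antisymm x y hxy hyx := by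
    rcases x with x | _ <;> rcases y with y | _ <;> simp only [Le] at *
    · exact congrArg of (hxy.antisymm hyx)
    · exact absurd (top_le_iff.1 (hyx ▸ hxy)) hu
    · exact absurd (top_le_iff.1 (hxy ▸ hyx)) hu
  le_sup_left x y := by
    rcases x with x | _ <;> rcases y with y | _ <;> simp only [join] <;> (try split_ifs) <;>
      simp_all [Le]
  le_sup_right x y := by
    rcases x with x | _ <;> rcases y with y | _ <;> simp only [join] <;> (try split_ifs) <;>
      simp_all [Le]
  sup_le x y z hxz hyz := by
    rcases x with x | _ <;> rcases y with y | _ <;> rcases z with z | _ <;> simp only [join] <;>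
      (try split_ifs) <;> simp_all [Le]
  inf_le_left x y := by
    rcases x with x | _ <;> rcases y with y | _ <;> simp only [meet] <;> (try split_ifs) <;>
      simp_all [Le]
  inf_le_right x y := by
    rcases x with x | _ <;> rcases y with y | _ <;> simp only [meet] <;> (try split_ifs) <;>
      simp_all [Le]
  le_inf x y z hxy hxz := by
    rcases x with x | _ <;> rcases y with y | _ <;> rcases z with z | _ <;> simp only [meet] <;>
      (try split_ifs) <;> simp_all [Le]

end AdjoinAbove

/-- The pair `(u, v)` lies in every congruence other than equality. -/
def IsBasePair {L : Type*} [Lattice L] (u v : L) : Prop :=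
  ∀ α : L → L → Prop, IsLatCongr α → α ≠ (fun x y : L => x = y) → α u v

theorem IsLatCongr.comap_s6 {K M : Type*} [Lattice K] [Lattice M] {f : K → M} (hf : IsLatHom f)
    {α : M → M → Prop} (hα : IsLatCongr α) : IsLatCongr (fun x y => α (f x) (f y)) := by
  refine ⟨⟨fun _ => hα.1.refl _, fun h => hα.1.symm h, fun h k => hα.1.trans h k⟩, ?_⟩
  intro x y a b h k
  beta_reduce
  rw [(hf x a).1, (hf y b).1, (hf x a).2, (hf y b).2]
  exact hα.2 _ _ _ _ h k

theorem IsLatCongr.dual {L : Type*} [Lattice L] {α : Lᵒᵈ → Lᵒᵈ → Prop} (hα : IsLatCongr α) :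
    IsLatCongr (fun x y : L => α (OrderDual.toDual x) (OrderDual.toDual y)) :=
  ⟨⟨fun _ => hα.1.refl _, fun h => hα.1.symm h, fun h k => hα.1.trans h k⟩,
    fun x y a b h k => (hα.2 x y a b h k).symm⟩

theorem IsLatCongr.sup_right {L : Type*} [Lattice L] {α : L → L → Prop} (hα : IsLatCongr α)
    {x y : L} (h : α x y) (z : L) : α (x ⊔ z) (y ⊔ z) :=
  (hα.2 _ _ _ _ h (hα.1.refl z)).2

theorem IsLatCongr.inf_right {L : Type*} [Lattice L] {α : L → L → Prop} (hα : IsLatCongr α)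
    {x y : L} (h : α x y) (z : L) : α (x ⊓ z) (y ⊓ z) :=
  (hα.2 _ _ _ _ h (hα.1.refl z)).1

/-- A congruence relating the bottom and the top element is total. -/
theorem IsLatCongr.of_isBot_isTop {L : Type*} [Lattice L] {α : L → L → Prop} (hα : IsLatCongr α)
    {b t : L} (hb : IsBot b) (ht : IsTop t) (h : α b t) (x y : L) : α x y := by
  have key : ∀ z, α b z := fun z => by
    simpa [inf_eq_left.2 (hb z), inf_eq_right.2 (ht z)] using hα.inf_right h z
  exact hα.1.trans (hα.1.symm (key x)) (key y)

/-- If some base pair `u < v` has `v ≠ ⊤`, then the top element is the join of two smaller ones. -/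
theorem IsBasePair.exists_sup_eq_top {L : Type*} [Lattice L] [BoundedOrder L] [Fintype L]
    {u v : L} (huv : u < v) (hv : v ≠ ⊤) (h : IsBasePair u v) :
    ∃ x y : L, x ≠ ⊤ ∧ y ≠ ⊤ ∧ x ⊔ y = ⊤ := by
  classical
  by_contra! hc
  obtain ⟨c, hct, hle⟩ : ∃ c : L, c ≠ ⊤ ∧ ∀ x, x ≠ ⊤ → x ≤ c := by
    refine ⟨(Finset.univ.filter (· ≠ (⊤ : L))).sup id, ?_, fun x hx => ?_⟩
    · exact Finset.sup_induction (p := (· ≠ (⊤ : L))) ((bot_le.trans_lt huv).trans_le le_top).ne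
        (fun x hx y hy => hc x y hx hy) (by simp)
    · exact Finset.le_sup (f := id) (by simpa using hx)
  have hα : IsLatCongr (fun x y : L => x = y ∨ c ≤ x ∧ c ≤ y) := by
    have absorb : ∀ x w : L, c ≤ x → w ≠ ⊤ → x ⊓ w = w := fun x w hx hw =>
      inf_eq_right.2 ((hle w hw).trans hx)
    refine ⟨⟨fun _ => .inl rfl, by grind, by grind⟩, ?_⟩
    rintro x y w z (rfl | ⟨hx, hy⟩) (rfl | ⟨hw, hz⟩)
    · exact ⟨.inl rfl, .inl rfl⟩
    · refine ⟨?_, .inr ⟨le_sup_of_le_right hw, le_sup_of_le_right hz⟩⟩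
      by_cases hxt : x = ⊤
      · subst hxt; simp [hw, hz]
      · left; rw [inf_comm, absorb w x hw hxt, inf_comm, absorb z x hz hxt]
    · refine ⟨?_, .inr ⟨le_sup_of_le_left hx, le_sup_of_le_left hy⟩⟩
      by_cases hwt : w = ⊤
      · subst hwt; simp [hx, hy]
      · left; rw [absorb x w hx hwt, absorb y w hy hwt]
    · exact ⟨.inr ⟨le_inf hx hw, le_inf hy hz⟩,
        .inr ⟨le_sup_of_le_left hx, le_sup_of_le_left hy⟩⟩
  rcases h _ hα fun e => hct ((congrFun (congrFun e c) ⊤).mp (.inr ⟨le_rfl, le_top⟩)) with e | e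
  · exact huv.ne e
  · exact (huv.trans_le (hle v hv)).not_ge e.1

/-- A base pair `u < v` survives in an extension by at most one element in which every congruence
relating `u` and `v` relates `u` to the top element. -/
theorem IsBasePair.exists_extension_top {L : Type u} [Lattice L] [Fintype L] {u v : L}
    (huv : u < v) (h : IsBasePair u v) :
    ∃ (M : Type u) (_ : Lattice M) (_ : Fintype M) (f : L → M),
      Fintype.card M ≤ Fintype.card L + 1 ∧ Function.Injective f ∧ IsLatHom f ∧
      IsBasePair (f u) (f v) ∧
      (∀ α : M → M → Prop, IsLatCongr α → α (f u) (f v) → ∀ t, IsTop t → α (f u) t) ∧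
      (∀ b, IsBot b → IsBot (f b)) := by
  classical
  have : Nonempty L := ⟨u⟩
  let : BoundedOrder L := Fintype.toBoundedOrder L
  by_cases hv : v = ⊤
  · refine ⟨L, inferInstance, inferInstance, id, Nat.le_succ _, Function.injective_id,
      fun _ _ => ⟨rfl, rfl⟩, h, fun α _ hα t ht => ?_, fun _ ht => ht⟩
    rwa [show t = v from hv ▸ ht.eq_top]
  have hu : u ≠ ⊤ := huv.ne_top
  let := AdjoinAbove.lattice hu
  let : Fintype (AdjoinAbove u) := Fintype.ofEquiv _ (AdjoinAbove.equivOption u)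
  let f : L → AdjoinAbove u := AdjoinAbove.of
  let a : AdjoinAbove u := AdjoinAbove.new
  have hf : IsLatHom f := fun _ _ => ⟨rfl, rfl⟩
  have inj : Function.Injective f := fun _ _ e => by injection e
  have htop : IsTop (f ⊤) := by
    rintro (x | _)
    · exact le_top (a := x)
    · rfl
  have sup_new : ∀ x, ¬ x ≤ u → a ⊔ f x = f ⊤ := fun x hx => if_neg hx
  have new_inf : ∀ x, x ≠ ⊤ → a ⊓ f x = f (x ⊓ u) := fun x hx => if_neg hx
  have le_new : f u ≤ a := le_refl u
  refine ⟨AdjoinAbove u, inferInstance, inferInstance, f, ?_, inj, hf, ?_, ?_, ?_⟩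
  · rw [← Fintype.card_congr (AdjoinAbove.equivOption u), Fintype.card_option]
  · intro α hα hne
    have base : ∀ x y, x ≠ y → α (f x) (f y) → α (f u) (f v) := fun x y hxy hr =>
      h _ (hα.comap_s6 hf) fun e => hxy ((congrFun (congrFun e x) y).mp hr)
    have new_of : ∀ x, α a (f x) → α (f u) (f v) := fun x hr => by
      by_cases hx : x = ⊤
      · have h1 := hα.inf_right (hx ▸ hr) (f v)
        rwa [new_inf v hv, inf_eq_right.2 huv.le, inf_eq_right.2 (htop _)] at h1
      have h1 := hα.inf_right hr a
      rw [inf_idem, inf_comm, new_inf x hx] at h1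
      have h2 := hα.sup_right h1 (f v)
      rw [sup_new v huv.not_ge, ← (hf _ _).2, sup_eq_right.2 (inf_le_right.trans huv.le)] at h2
      exact base _ _ (Ne.symm hv) h2
    by_contra hc
    refine hne (funext fun x => funext fun y => propext ⟨fun hr => ?_, fun e => e ▸ hα.1.refl x⟩)
    rcases x with x | _ <;> rcases y with y | _
    · by_contra hxy
      exact hc (base x y (fun e => hxy (congrArg f e)) hr)
    · exact absurd (new_of x (hα.1.symm hr)) hc
    · exact absurd (new_of y hr) hc
    · rfl
  · intro α hα hr t ht
    rw [show t = f ⊤ from (htop t).antisymm (ht _)]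
    have h1 := hα.sup_right hr a
    rw [sup_eq_right.2 le_new, sup_comm, sup_new v huv.not_ge] at h1
    have h2 : ∀ x, x ≠ ⊤ → α (f u) (f (x ⊔ u)) := fun x hx => by
      have h3 := hα.sup_right (hα.inf_right h1 (f x)) (f u)
      rwa [new_inf x hx, inf_eq_right.2 (htop _), ← (hf _ _).2, ← (hf _ _).2,
        sup_eq_right.2 inf_le_right] at h3
    obtain ⟨x, y, hx, hy, hxy⟩ := h.exists_sup_eq_top huv hv
    have h4 := (hα.2 _ _ _ _ (h2 x hx) (h2 y hy)).2
    rwa [sup_idem, ← (hf _ _).2, ← sup_sup_distrib_right, hxy, top_sup_eq] at h4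
  · rintro b hb (x | _)
    exacts [hb x, hb u]

/-- The dual of `IsBasePair.exists_extension_top`. -/
theorem IsBasePair.exists_extension_bot {L : Type u} [Lattice L] [Fintype L] {u v : L}
    (huv : u < v) (h : IsBasePair u v) :
    ∃ (M : Type u) (_ : Lattice M) (_ : Fintype M) (f : L → M),
      Fintype.card M ≤ Fintype.card L + 1 ∧ Function.Injective f ∧ IsLatHom f ∧
      IsBasePair (f u) (f v) ∧
      (∀ α : M → M → Prop, IsLatCongr α → α (f u) (f v) → ∀ b, IsBot b → α (f v) b) ∧
      (∀ t, IsTop t → IsTop (f t)) := by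
  have hd : IsBasePair (OrderDual.toDual v) (OrderDual.toDual u) := fun α hα hne =>
    hα.1.symm (h _ hα.dual hne)
  obtain ⟨M, _, _, f, hcard, inj, hf, hb, htop, hbot⟩ :=
    hd.exists_extension_top (L := Lᵒᵈ) (OrderDual.toDual_lt_toDual.2 huv)
  refine ⟨Mᵒᵈ, inferInstance, inferInstance,
    fun x => OrderDual.toDual (f (OrderDual.toDual x)), hcard, fun x y e => inj e,
    fun x y => (hf (OrderDual.toDual x) (OrderDual.toDual y)).symm, ?_, ?_, ?_⟩
  · exact fun α hα hne => hα.1.symm (hb _ hα.dual hne)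
  · exact fun α hα hr b hb => htop _ hα.dual (hα.1.symm hr) _ hb
  · exact fun t ht => hbot _ ht

/-- Every finite subdirectly irreducible lattice embeds into a finite simple lattice
with at most two extra elements. -/
theorem subdirectly_irreducible_embeds_in_simple {L : Type u} [Lattice L] [Fintype L]
    (hcard : 1 < Fintype.card L) (u v : L) (huv : u < v)
    (hbase : ∀ α : L → L → Prop, IsLatCongr α → α ≠ (fun x y : L => x = y) → α u v) :
    ∃ (M : Type u) (instM : Lattice M) (_ : Fintype M),
      Fintype.card M ≤ Fintype.card L + 2 ∧ @IsSimpleLattice M instM ∧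
      ∃ f : L → M, Function.Injective f ∧ @IsLatHom L M _ instM f := by
  obtain ⟨M, _, _, f, hfcard, finj, hf, hfb, hftop, -⟩ :=
    IsBasePair.exists_extension_top huv hbase
  have hfuv : f u < f v := lt_of_le_of_ne
    (by rw [← sup_eq_right, ← (hf u v).2, sup_eq_right.2 huv.le]) (finj.ne huv.ne)
  obtain ⟨N, _, _, g, hgcard, ginj, hg, hgb, hgbot, hgtop⟩ := hfb.exists_extension_bot hfuv
  have : Nonempty M := ⟨f u⟩
  have : Nonempty N := ⟨g (f u)⟩
  let : BoundedOrder M := Fintype.toBoundedOrder M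
  let : BoundedOrder N := Fintype.toBoundedOrder N
  refine ⟨N, inferInstance, inferInstance, by omega,
    ⟨⟨g (f u), g (f v), (ginj.comp finj).ne huv.ne⟩,
      fun α hα => or_iff_not_imp_left.2 fun hne => ?_⟩,
    g ∘ f, ginj.comp finj, fun x y => ?_⟩
  · have huv' := hgb α hα hne
    have hbot := hgbot α hα huv' ⊥ isBot_bot
    have htop := hftop _ (hα.comap_s6 hg) huv' ⊤ isTop_top
    funext x y
    exact eq_true (hα.of_isBot_isTop isBot_bot (hgtop _ isTop_top)
      (hα.1.trans (hα.1.symm hbot) (hα.1.trans (hα.1.symm huv') htop)) x y)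
  · simp only [Function.comp_apply, hf x y, hg (f x) (f y), and_self]
end

section
/- Every finitely generated distributive lattice is finite: if D is a distributive lattice and S is a finite nonempty subset of D, then the smallest subset of D containing S and closed under ⊔ and ⊓ (the sublattice generated by S) is finite. -/
/-- **Lemma 2.14**: a finitely generated distributive lattice is finite: for any
finite nonempty subset `S` of a distributive lattice `D`, the smallest subset of `D`
containing `S` and closed under `⊔` and `⊓` (the sublattice generated by `S`)
is finite. -/
theorem finitely_generated_distributive_is_finite {D : Type*} [DistribLattice D]
    (S : Set D) (hfin : S.Finite) (hne : S.Nonempty) :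
    Set.Finite
      (⋂₀ {T : Set D | S ⊆ T ∧ ∀ x ∈ T, ∀ y ∈ T, x ⊔ y ∈ T ∧ x ⊓ y ∈ T}) := by
  refine hfin.latticeClosure.subset (Set.sInter_subset_of_mem ⟨subset_latticeClosure, ?_⟩)
  exact fun x hx y hy =>
    ⟨isSublattice_latticeClosure.supClosed hx hy, isSublattice_latticeClosure.infClosed hx hy⟩
end

section
/- A finite lattice L is modular if and only if it is both upper semimodular and lower semimodular, where L is upper semimodular if for all a, b, c ∈ L, a ⋖ b implies a ⊔ c = b ⊔ c or a ⊔ c ⋖ b ⊔ c, and lower semimodular if the dual condition holds (a ⋖ b implies a ⊓ c = b ⊓ c or a ⊓ c ⋖ b ⊓ c). -/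
theorem CovBy.sup_eq_or_covBy_sup {α : Type*} [Lattice α] [IsUpperModularLattice α] {a b : α}
    (h : a ⋖ b) (c : α) : a ⊔ c = b ⊔ c ∨ a ⊔ c ⋖ b ⊔ c := by
  have hsup : b ⊔ (a ⊔ c) = b ⊔ c := by rw [← sup_assoc, sup_eq_left.2 h.le]
  rcases h.eq_or_eq (le_inf h.le le_sup_left) inf_le_left with hinf | hinf
  · right
    rw [← hsup]
    exact covBy_sup_of_inf_covBy_left (hinf.symm ▸ h)
  · left
    rw [← hsup, sup_eq_right.2 (inf_eq_left.1 hinf)]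

theorem CovBy.inf_eq_or_covBy_inf {α : Type*} [Lattice α] [IsLowerModularLattice α] {a b : α}
    (h : a ⋖ b) (c : α) : a ⊓ c = b ⊓ c ∨ a ⊓ c ⋖ b ⊓ c :=
  (h.toDual.sup_eq_or_covBy_sup (OrderDual.toDual c)).imp Eq.symm CovBy.ofDual

/-- A lattice satisfying both semimodularity conditions has no pentagon `x < z`, `y`, provided it
is strongly atomic and has no infinite ascending chain. -/
theorem eq_of_le_of_inf_eq_of_sup_eq_of_semimodular {α : Type*} [Lattice α] [IsStronglyAtomic α]
    [WellFoundedGT α]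
    (hup : ∀ a b c : α, a ⋖ b → a ⊔ c = b ⊔ c ∨ a ⊔ c ⋖ b ⊔ c)
    (hlow : ∀ a b c : α, a ⋖ b → a ⊓ c = b ⊓ c ∨ a ⊓ c ⋖ b ⊓ c)
    {x z : α} (y : α) (hxz : x ≤ z) (hinf : x ⊓ y = z ⊓ y) (hsup : x ⊔ y = z ⊔ y) : x = z := by
  induction x using WellFoundedGT.induction generalizing z with
  | ind x ih =>
    by_cases hyx : y ≤ x
    · rwa [sup_eq_left.2 hyx, sup_eq_left.2 (hyx.trans hxz)] at hsup
    obtain ⟨a, hoa, hay⟩ := exists_covBy_le_of_lt (inf_lt_right.2 hyx)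
    have step : ∀ w, w ⊓ y = x ⊓ y → w ⋖ w ⊔ a ∧ (w ⊔ a) ⊓ y = a := by
      intro w hw
      have how : x ⊓ y ≤ w := hw ▸ inf_le_left
      have hcov : w ⋖ w ⊔ a := by
        rcases hup _ _ w hoa with h | h
        · rw [sup_eq_right.2 how] at h
          have haw : a ≤ w := h ▸ le_sup_left
          exact absurd (hw ▸ le_inf haw hay) hoa.lt.not_ge
        · rwa [sup_eq_right.2 how, sup_comm] at h
      have hle : a ≤ (w ⊔ a) ⊓ y := le_inf le_sup_right hay
      refine ⟨hcov, ?_⟩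
      rcases hlow _ _ y hcov with h | h
      · exact absurd ((h.symm.trans hw) ▸ hle) hoa.lt.not_ge
      · rw [hw] at h
        exact ((h.eq_or_eq hoa.le hle).resolve_left hoa.lt.ne').symm
    obtain ⟨hx, hxa⟩ := step x rfl
    obtain ⟨hz, hza⟩ := step z hinf.symm
    have heq : x ⊔ a = z ⊔ a := by
      refine ih _ hx.lt (sup_le_sup_right hxz a) (hxa.trans hza.symm) ?_
      rw [sup_assoc, sup_assoc, sup_eq_right.2 hay, hsup]
    exact (hx.eq_or_eq hxz (heq ▸ le_sup_left)).elim Eq.symm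
      fun h => absurd (h.trans heq) hz.lt.ne

/-- **Lemma 2.21**: a finite lattice is modular iff it is both upper semimodular
(`a ⋖ b` implies `a ⊔ c = b ⊔ c` or `a ⊔ c ⋖ b ⊔ c`) and lower semimodular
(`a ⋖ b` implies `a ⊓ c = b ⊓ c` or `a ⊓ c ⋖ b ⊓ c`). -/
theorem finite_modular_iff_upper_and_lower_semimodular
    {L : Type*} [Lattice L] [Fintype L] :
    (∀ x y z : L, x ≤ z → x ⊔ (y ⊓ z) = (x ⊔ y) ⊓ z) ↔
      ((∀ a b c : L, a ⋖ b → a ⊔ c = b ⊔ c ∨ a ⊔ c ⋖ b ⊔ c) ∧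
       (∀ a b c : L, a ⋖ b → a ⊓ c = b ⊓ c ∨ a ⊓ c ⋖ b ⊓ c)) := by
  constructor
  · intro h
    have : IsModularLattice L := ⟨fun {x} y {z} hxz => (h x y z hxz).ge⟩
    exact ⟨fun _ _ c hab => hab.sup_eq_or_covBy_sup c, fun _ _ c hab => hab.inf_eq_or_covBy_inf c⟩
  · rintro ⟨hup, hlow⟩ x y z hxz
    have hle : x ⊔ y ⊓ z ≤ (x ⊔ y) ⊓ z :=
      le_inf (sup_le_sup_left inf_le_left x) (sup_le hxz inf_le_right)
    refine eq_of_le_of_inf_eq_of_sup_eq_of_semimodular hup hlow y hle ?_ ?_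
    · apply le_antisymm
      · exact inf_le_inf_right y hle
      · exact le_inf ((le_inf inf_le_right (inf_le_left.trans inf_le_right)).trans le_sup_right)
          inf_le_right
    · apply le_antisymm
      · exact sup_le_sup_right hle y
      · exact sup_le (inf_le_left.trans (sup_le_sup_right le_sup_left y)) le_sup_right
end

section
/- Let x, y, z be elements of a lattice L such that x ⊔ y, y ⊔ z, and z ⊔ x are pairwise incomparable. Then the sublattice of L generated by {x ⊔ y, y ⊔ z, z ⊔ x} is isomorphic to the eight-element Boolean lattice B₃; that is, there exists an injective lattice homomorphism f from the lattice of all subsets of a three-element set {0,1,2} into L with f({0,1,2}∖{0}) = y ⊔ z, f({0,1,2}∖{1}) = z ⊔ x, and f({0,1,2}∖{2}) = x ⊔ y. -/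
/-- The meet of those elements `a i` whose index `i` lies outside `A`, computed below `t`. -/
noncomputable def meetOutside {L : Type*} [Lattice L] (t : L) (a : Fin 3 → L)
    (A : Set (Fin 3)) : L :=
  open Classical in
  (if 0 ∈ A then t else a 0) ⊓ (if 1 ∈ A then t else a 1) ⊓ (if 2 ∈ A then t else a 2)

/-- The join of those elements `p i` whose index `i` lies in `A`, computed above `b`. -/
noncomputable def joinInside {L : Type*} [Lattice L] (b : L) (p : Fin 3 → L)
    (A : Set (Fin 3)) : L :=
  open Classical in
  (if 0 ∈ A then p 0 else b) ⊔ (if 1 ∈ A then p 1 else b) ⊔ (if 2 ∈ A then p 2 else b)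

theorem meetOutside_inter {L : Type*} [Lattice L] {t : L} {a : Fin 3 → L} (h : ∀ i, a i ≤ t)
    (A B : Set (Fin 3)) :
    meetOutside t a (A ∩ B) = meetOutside t a A ⊓ meetOutside t a B := by
  classical
  have key (i : Fin 3) : @ite _ (i ∈ A ∩ B) (Classical.propDecidable _) t (a i) =
      (if i ∈ A then t else a i) ⊓ (if i ∈ B then t else a i) := by
    by_cases hA : i ∈ A <;> by_cases hB : i ∈ B <;> simp [hA, hB, h i]
  simp only [meetOutside, key]
  ac_rfl

theorem joinInside_union {L : Type*} [Lattice L] {b : L} {p : Fin 3 → L} (h : ∀ i, b ≤ p i)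
    (A B : Set (Fin 3)) :
    joinInside b p (A ∪ B) = joinInside b p A ⊔ joinInside b p B := by
  classical
  have key (i : Fin 3) : @ite _ (i ∈ A ∪ B) (Classical.propDecidable _) (p i) b =
      (if i ∈ A then p i else b) ⊔ (if i ∈ B then p i else b) := by
    by_cases hA : i ∈ A <;> by_cases hB : i ∈ B <;> simp [hA, hB, h i]
  simp only [joinInside, key]
  ac_rfl

theorem meetOutside_le {L : Type*} [Lattice L] {t : L} {a : Fin 3 → L} {A : Set (Fin 3)}
    {i : Fin 3} (hi : i ∉ A) : meetOutside t a A ≤ a i := by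
  classical
  unfold meetOutside
  fin_cases i
  · exact inf_le_left.trans (inf_le_left.trans (if_neg hi).le)
  · exact inf_le_left.trans (inf_le_right.trans (if_neg hi).le)
  · exact inf_le_right.trans (if_neg hi).le

theorem le_joinInside {L : Type*} [Lattice L] {b : L} {p : Fin 3 → L} {A : Set (Fin 3)}
    {i : Fin 3} (hi : i ∈ A) : p i ≤ joinInside b p A := by
  classical
  unfold joinInside
  fin_cases i
  · exact (if_pos hi).ge.trans (le_sup_left.trans le_sup_left)
  · exact (if_pos hi).ge.trans (le_sup_right.trans le_sup_left)
  · exact (if_pos hi).ge.trans le_sup_right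

/-- The meets of `x ⊔ y` with `x ⊔ z` and with `y ⊔ z` join to `x ⊔ y`. -/
theorem sup_inf_sup_sup_inf_sup {L : Type*} [Lattice L] (x y z : L) :
    (x ⊔ y) ⊓ (x ⊔ z) ⊔ (x ⊔ y) ⊓ (y ⊔ z) = x ⊔ y :=
  le_antisymm (sup_le inf_le_left inf_le_left)
    (sup_le_sup (le_inf le_sup_left le_sup_left) (le_inf le_sup_right le_sup_left))

/-- **Lemma 2.6**: if `x ⊔ y`, `y ⊔ z`, `z ⊔ x` are pairwise incomparable in a
lattice `L`, then the sublattice they generate is isomorphic to the eight-element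
Boolean lattice `B₃`: there is an injective lattice homomorphism `f` from the
lattice of subsets of a three-element set into `L` sending the three coatoms to
`y ⊔ z`, `z ⊔ x`, `x ⊔ y`. -/
theorem free_boolean_on_incomparable_joins {L : Type*} [Lattice L] (x y z : L)
    (h12 : ¬ (x ⊔ y ≤ y ⊔ z) ∧ ¬ (y ⊔ z ≤ x ⊔ y))
    (h23 : ¬ (y ⊔ z ≤ z ⊔ x) ∧ ¬ (z ⊔ x ≤ y ⊔ z))
    (h13 : ¬ (x ⊔ y ≤ z ⊔ x) ∧ ¬ (z ⊔ x ≤ x ⊔ y)) :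
    ∃ f : Set (Fin 3) → L, Function.Injective f ∧
      (∀ A B : Set (Fin 3), f (A ∪ B) = f A ⊔ f B ∧ f (A ∩ B) = f A ⊓ f B) ∧
      f ({1, 2} : Set (Fin 3)) = y ⊔ z ∧
      f ({0, 2} : Set (Fin 3)) = z ⊔ x ∧
      f ({0, 1} : Set (Fin 3)) = x ⊔ y := by
  classical
  set a : L := y ⊔ z with ha
  set b : L := z ⊔ x with hb
  set c : L := x ⊔ y with hc
  have hpq : b ⊓ c ⊔ a ⊓ c = c := by
    simpa only [ha, hb, hc, sup_comm, inf_comm] using sup_inf_sup_sup_inf_sup x y z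
  have hpr : b ⊓ c ⊔ a ⊓ b = b := by
    simpa only [ha, hb, hc, sup_comm, inf_comm] using sup_inf_sup_sup_inf_sup x z y
  have hqr : a ⊓ c ⊔ a ⊓ b = a := by
    simpa only [ha, hb, hc, sup_comm, inf_comm] using sup_inf_sup_sup_inf_sup y z x
  have hct : c ⊔ a ⊓ b = x ⊔ y ⊔ z :=
    le_antisymm (sup_le le_sup_left (inf_le_left.trans (sup_le (le_sup_right.trans le_sup_left)
      le_sup_right))) (sup_le_sup le_rfl (le_inf le_sup_right le_sup_left))
  set t : L := x ⊔ y ⊔ z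
  have hat : a ≤ t := sup_le (le_sup_right.trans le_sup_left) le_sup_right
  have hbt : b ≤ t := sup_le le_sup_right (le_sup_left.trans le_sup_left)
  have hct' : c ≤ t := le_sup_left
  have hp : a ⊓ b ⊓ c ≤ b ⊓ c := inf_le_inf_right c inf_le_right
  have hq : a ⊓ b ⊓ c ≤ a ⊓ c := inf_le_inf_right c inf_le_left
  have hr : a ⊓ b ⊓ c ≤ a ⊓ b := inf_le_left
  have hmj (A : Set (Fin 3)) : meetOutside t ![a, b, c] A =
      joinInside (a ⊓ b ⊓ c) ![b ⊓ c, a ⊓ c, a ⊓ b] A := by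
    by_cases h0 : 0 ∈ A <;> by_cases h1 : 1 ∈ A <;> by_cases h2 : 2 ∈ A <;>
      simp only [meetOutside, joinInside, h0, h1, h2, if_true, if_false, Matrix.cons_val,
        inf_idem, sup_idem, inf_eq_left.2 hat, inf_eq_left.2 hbt,
        inf_eq_right.2 hbt, inf_eq_right.2 hct',
        inf_eq_left.2 (inf_le_left.trans hat : a ⊓ b ≤ t), sup_eq_left.2 hp,
        sup_eq_left.2 hq, sup_eq_right.2 hq, sup_eq_right.2 hr, hpq, hpr, hqr, hct,
        sup_eq_left.2 (inf_le_right : a ⊓ b ⊓ c ≤ c)]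
  have hsub {A B : Set (Fin 3)}
      (h : meetOutside t ![a, b, c] A = meetOutside t ![a, b, c] B) : A ⊆ B := by
    intro i hi
    by_contra hB
    have hle : (![b ⊓ c, a ⊓ c, a ⊓ b] : Fin 3 → L) i ≤ (![a, b, c] : Fin 3 → L) i :=
      (le_joinInside hi).trans ((hmj A).ge.trans (h.le.trans (meetOutside_le hB)))
    fin_cases i
    · exact h12.1 (hpq.ge.trans (sup_le hle inf_le_left))
    · exact h13.1 (hpq.ge.trans (sup_le inf_le_left hle))
    · exact h13.2 (hpr.ge.trans (sup_le inf_le_right hle))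
  refine ⟨meetOutside t ![a, b, c], fun A B h => (hsub h).antisymm (hsub h.symm),
    fun A B => ⟨?_, meetOutside_inter ?_ A B⟩, ?_, ?_, ?_⟩
  · simp only [hmj]
    refine joinInside_union ?_ A B
    simp only [Fin.forall_fin_succ]
    exact ⟨hp, hq, hr, fun i => i.elim0⟩
  · simp only [Fin.forall_fin_succ]
    exact ⟨hat, hbt, hct', fun i => i.elim0⟩
  · simp [meetOutside, hat]
  · simp [meetOutside, hbt]
  · simp [meetOutside, hct']
end

section
/- Let L be a lattice and a, b, c, d ∈ L with a ≤ b and c ≤ d. Then c and d are related by con(a, b), the least congruence of L collapsing a and b, if and only if there exist m ≥ 0 and a chain c = e₀ ≤ e₁ ≤ ⋯ ≤ e_m = d such that [a, b] is congruence-projective onto [e_j, e_{j+1}] for every j = 0, …, m−1 (Dilworth's description of principal congruences). -/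
/-- `latConGen a b`: the least congruence of `L` collapsing `a` and `b`, i.e. the
intersection of all congruences containing the pair `(a, b)`. -/
def latConGen {L : Type*} [Lattice L] (a b : L) : L → L → Prop :=
  fun x y => ∀ t : L → L → Prop, IsLatCongr t → t a b → t x y

/-- `[p.1, p.2]` is congruence-perspective onto `[q.1, q.2]`: either up
(`q.2 = p.2 ⊔ q.1` and `p.1 ≤ p.2 ⊓ q.1`) or down
(`q.1 = p.1 ⊓ q.2` and `p.1 ⊔ q.2 ≤ p.2`). -/
def CongPersp {L : Type*} [Lattice L] (p q : L × L) : Prop :=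
  (q.2 = p.2 ⊔ q.1 ∧ p.1 ≤ p.2 ⊓ q.1) ∨ (q.1 = p.1 ⊓ q.2 ∧ p.1 ⊔ q.2 ≤ p.2)

/-- Congruence-projectivity: the reflexive-transitive closure of
congruence-perspectivity. -/
def CongProj {L : Type*} [Lattice L] : L × L → L × L → Prop :=
  Relation.ReflTransGen CongPersp

section CongruenceChains

variable {L : Type*} [Lattice L]

lemma congPersp_inf_right {x y : L} (h : x ≤ y) (t : L) : CongPersp (x, y) (x ⊓ t, y ⊓ t) :=
  Or.inr ⟨by simp [← inf_assoc, inf_eq_left.mpr h], sup_le h inf_le_left⟩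

lemma congPersp_sup_right {x y : L} (h : x ≤ y) (t : L) : CongPersp (x, y) (x ⊔ t, y ⊔ t) :=
  Or.inl ⟨by simp [← sup_assoc, sup_eq_left.mpr h], le_inf h le_sup_left⟩

lemma IsLatCongr.of_congPersp {r : L → L → Prop} (hr : IsLatCongr r) {p q : L × L}
    (hpq : CongPersp p q) (hp : r p.1 p.2) : r q.1 q.2 := by
  rcases hpq with ⟨h₁, h₂⟩ | ⟨h₁, h₂⟩
  · have h := (hr.2 _ _ _ _ hp (hr.1.refl q.1)).2
    rwa [sup_eq_right.mpr (h₂.trans inf_le_right), ← h₁] at h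
  · have h := (hr.2 _ _ _ _ hp (hr.1.refl q.2)).1
    rwa [inf_eq_right.mpr (le_sup_right.trans h₂), ← h₁] at h

lemma IsLatCongr.of_congProj {r : L → L → Prop} (hr : IsLatCongr r) {p q : L × L}
    (hpq : CongProj p q) (hp : r p.1 p.2) : r q.1 q.2 := by
  induction hpq with
  | refl => exact hp
  | tail _ h ih => exact hr.of_congPersp h ih

/-- `CongChain a b x y`: there is an ascending chain from `x` to `y` such that `[a, b]` is
congruence-projective onto each of its steps. -/
def CongChain (a b : L) : L → L → Prop :=
  Relation.ReflTransGen fun x y => x ≤ y ∧ CongProj (a, b) (x, y)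

lemma CongChain.inf_right {a b x y : L} (h : CongChain a b x y) (t : L) :
    CongChain a b (x ⊓ t) (y ⊓ t) :=
  Relation.ReflTransGen.lift (· ⊓ t) (fun _ _ h =>
    ⟨inf_le_inf_right t h.1, h.2.tail (congPersp_inf_right h.1 t)⟩) _ _ h

lemma CongChain.sup_right {a b x y : L} (h : CongChain a b x y) (t : L) :
    CongChain a b (x ⊔ t) (y ⊔ t) :=
  Relation.ReflTransGen.lift (· ⊔ t) (fun _ _ h =>
    ⟨sup_le_sup_right h.1 t, h.2.tail (congPersp_sup_right h.1 t)⟩) _ _ h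

lemma CongChain.exists_seq {a b x y : L} (h : CongChain a b x y) :
    ∃ (m : ℕ) (e : ℕ → L), e 0 = x ∧ e m = y ∧
      (∀ j : ℕ, j < m → e j ≤ e (j + 1)) ∧
      (∀ j : ℕ, j < m → CongProj (a, b) (e j, e (j + 1))) := by
  induction h using Relation.ReflTransGen.head_induction_on with
  | refl => exact ⟨0, fun _ => y, rfl, rfl, by simp, by simp⟩
  | @head x z hxz _ ih =>
    obtain ⟨m, e, rfl, rfl, hle, hproj⟩ := ih
    refine ⟨m + 1, fun n => Nat.casesOn n x e, rfl, rfl, ?_, ?_⟩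
    · rintro (_ | j) hj
      exacts [hxz.1, hle j (Nat.lt_of_succ_lt_succ hj)]
    · rintro (_ | j) hj
      exacts [hxz.2, hproj j (Nat.lt_of_succ_lt_succ hj)]

/-- The lattice congruence relating `x` and `y` when a chain of intervals onto which `[a, b]` is
congruence-projective leads from `x ⊓ y` to `x ⊔ y`. -/
def congChainCon (a b : L) : LatticeCon L :=
  haveI : Std.Refl fun x y : L => CongChain a b (x ⊓ y) (x ⊔ y) :=
    ⟨fun x => by simpa using (show CongChain a b x x from Relation.ReflTransGen.refl)⟩
  LatticeCon.mk' (fun x y => CongChain a b (x ⊓ y) (x ⊔ y))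
    (fun x y => by
      rw [inf_eq_left.mpr (inf_le_sup : x ⊓ y ≤ x ⊔ y),
        sup_eq_right.mpr (inf_le_sup : x ⊓ y ≤ x ⊔ y)])
    (fun x y z hxy hyz h₁ h₂ => by
      rw [inf_eq_left.mpr hxy, sup_eq_right.mpr hxy] at h₁
      rw [inf_eq_left.mpr hyz, sup_eq_right.mpr hyz] at h₂
      rw [inf_eq_left.mpr (hxy.trans hyz), sup_eq_right.mpr (hxy.trans hyz)]
      exact Relation.ReflTransGen.trans h₁ h₂)
    (fun x y t hxy h => by
      rw [inf_eq_left.mpr hxy, sup_eq_right.mpr hxy] at h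
      rw [inf_eq_left.mpr (inf_le_inf_right t hxy), sup_eq_right.mpr (inf_le_inf_right t hxy),
        inf_eq_left.mpr (sup_le_sup_right hxy t), sup_eq_right.mpr (sup_le_sup_right hxy t)]
      exact ⟨h.inf_right t, h.sup_right t⟩)

lemma congChainCon_iff {a b x y : L} (h : x ≤ y) :
    (congChainCon a b).r x y ↔ CongChain a b x y := by
  change CongChain a b (x ⊓ y) (x ⊔ y) ↔ _
  rw [inf_eq_left.mpr h, sup_eq_right.mpr h]

lemma LatticeCon.isLatCongr (s : LatticeCon L) : IsLatCongr s.r :=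
  ⟨s.iseqv, fun _ _ _ _ h₁ h₂ => ⟨s.inf h₁ h₂, s.sup h₁ h₂⟩⟩

end CongruenceChains

/-- **Dilworth's description of principal congruences** (Theorem 3.1): for `a ≤ b`
and `c ≤ d` in a lattice `L`, `c ≡ d (mod con(a,b))` iff there is a chain
`c = e₀ ≤ e₁ ≤ ⋯ ≤ e_m = d` with `[a, b]` congruence-projective onto each
`[e_j, e_{j+1}]`. -/
theorem principal_congruence_description {L : Type*} [Lattice L]
    (a b c d : L) (hab : a ≤ b) (hcd : c ≤ d) :
    latConGen a b c d ↔
      ∃ (m : ℕ) (e : ℕ → L), e 0 = c ∧ e m = d ∧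
        (∀ j : ℕ, j < m → e j ≤ e (j + 1)) ∧
        (∀ j : ℕ, j < m → CongProj (a, b) (e j, e (j + 1))) := by
  constructor
  · intro h
    have hcon : (congChainCon a b).r c d :=
      h _ (congChainCon a b).isLatCongr
        ((congChainCon_iff hab).mpr (Relation.ReflTransGen.single ⟨hab, .refl⟩))
    exact ((congChainCon_iff hcd).mp hcon).exists_seq
  · rintro ⟨m, e, rfl, rfl, -, hproj⟩ r hr hrab
    clear hcd
    induction m with
    | zero => exact hr.1.refl _
    | succ m ih =>
      exact hr.1.trans
        (ih fun j hj => hproj j (hj.trans m.lt_succ_self))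
        (hr.of_congProj (hproj m m.lt_succ_self) hrab)
end

section
/- A finite distributive lattice with a three-element filter cannot be represented as the congruence lattice of a finite semidistributive lattice; equivalently, if K is a finite lattice satisfying both semidistributive laws (SD_⊓) and (SD_⊔), then no filter of the congruence lattice of K has exactly three elements, where a filter of the congruence lattice is a nonempty set F of congruences of K that is upward closed under inclusion and closed under intersection of two members. -/
namespace IsLatCongr

variable {L : Type*} [Lattice L] {r s : L → L → Prop}

lemma inter (hr : IsLatCongr r) (hs : IsLatCongr s) :
    IsLatCongr fun x y => r x y ∧ s x y :=
  ⟨⟨fun x => ⟨hr.1.refl x, hs.1.refl x⟩, fun h => ⟨hr.1.symm h.1, hs.1.symm h.2⟩,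
      fun h k => ⟨hr.1.trans h.1 k.1, hs.1.trans h.2 k.2⟩⟩,
    fun x y u v h k => ⟨⟨(hr.2 x y u v h.1 k.1).1, (hs.2 x y u v h.2 k.2).1⟩,
      ⟨(hr.2 x y u v h.1 k.1).2, (hs.2 x y u v h.2 k.2).2⟩⟩⟩

lemma total : IsLatCongr fun _ _ : L => True :=
  ⟨⟨fun _ => trivial, fun _ => trivial, fun _ _ => trivial⟩,
    fun _ _ _ _ _ _ => ⟨trivial, trivial⟩⟩

lemma dual_s16 (hr : IsLatCongr r) : IsLatCongr (L := Lᵒᵈ) r :=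
  ⟨hr.1, fun x y u v h k => (hr.2 x y u v h k).symm⟩

lemma rel_of_rel_bot_top [BoundedOrder L] (hr : IsLatCongr r) (h : r ⊥ ⊤) (x y : L) :
    r x y := by
  have key (z : L) : r z ⊤ := by simpa using (hr.2 _ _ _ _ (hr.1.refl z) h).2
  exact hr.1.trans (key x) (hr.1.symm (key y))

/-- In a finite meet-semidistributive lattice, below every element that is not congruent to `⊥`
there is an element, again not congruent to `⊥`, whose principal filter and its complement are
the classes of a larger congruence. -/
lemma exists_le_isLatCongr_le_iff [BoundedOrder L] [Finite L]
    (hSD : ∀ x y z : L, x ⊓ y = x ⊓ z → x ⊓ y = x ⊓ (y ⊔ z))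
    (hr : IsLatCongr r) {x : L} (hx : ¬ r x ⊥) :
    ∃ a ≤ x, a ≠ ⊥ ∧ IsLatCongr (fun y z => a ≤ y ↔ a ≤ z) ∧
      ∀ y z, r y z → (a ≤ y ↔ a ≤ z) := by
  obtain ⟨a, hax, ha⟩ := (Set.toFinite {y : L | ¬ r y ⊥}).exists_le_minimal hx
  obtain ⟨b, -, hb⟩ := (Set.toFinite {y : L | r y ⊥}).exists_le_maximal (hr.1.refl ⊥)
  have har : ¬ r a ⊥ := ha.prop
  have hbr : r b ⊥ := hb.prop
  have le_b {z : L} (hz : r z ⊥) : z ≤ b := by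
    have h : r (b ⊔ z) ⊥ := by simpa using (hr.2 _ _ _ _ hbr hz).2
    exact le_sup_right.trans (hb.le_of_ge h le_sup_left)
  have a_le {z : L} (hz : ¬ r (a ⊓ z) ⊥) : a ≤ z :=
    (ha.le_of_le hz inf_le_left).trans inf_le_right
  have le_of_rel {y z : L} (h : r y z) (hy : a ≤ y) : a ≤ z := by
    refine a_le fun hz => har ?_
    have h' := (hr.2 _ _ _ _ (hr.1.refl a) h).1
    rw [inf_eq_left.2 hy] at h'
    exact hr.1.trans h' hz
  have hb_le (z : L) (hz : ¬ a ≤ z) : a ⊓ (z ⊔ b) = a ⊓ b := by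
    have h : r (z ⊔ b) z := by simpa using (hr.2 _ _ _ _ (hr.1.refl z) hbr).2
    have h' : r (a ⊓ (z ⊔ b)) ⊥ := by
      by_contra h'
      exact hz (le_of_rel h (a_le h'))
    exact le_antisymm (le_inf inf_le_left (le_b h')) (inf_le_inf_left _ le_sup_right)
  have a_prime {y z : L} (h : a ≤ y ⊔ z) : a ≤ y ∨ a ≤ z := by
    by_contra! hyz
    have h₁ := hb_le y hyz.1
    have h₂ := hSD a (y ⊔ b) (z ⊔ b) (h₁.trans (hb_le z hyz.2).symm)
    rw [h₁, inf_eq_left.2 (h.trans (sup_le_sup le_sup_left le_sup_left))] at h₂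
    have hab : a ≤ b := inf_eq_left.1 h₂
    refine har ?_
    have h₃ := (hr.2 _ _ _ _ (hr.1.refl a) hbr).1
    simpa [inf_eq_left.2 hab] using h₃
  have sup_iff (y z : L) : a ≤ y ⊔ z ↔ a ≤ y ∨ a ≤ z :=
    ⟨a_prime, fun h => h.elim le_sup_of_le_left le_sup_of_le_right⟩
  refine ⟨a, hax, ?_, ⟨⟨fun _ => Iff.rfl, Iff.symm, Iff.trans⟩, fun x y u v h k => ?_⟩,
    fun y z h => ⟨le_of_rel h, le_of_rel (hr.1.symm h)⟩⟩
  · rintro rfl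
    exact har (hr.1.refl _)
  · simp only [sup_iff, le_inf_iff, h, k, and_self]

end IsLatCongr

/-- A congruence with exactly two classes, those of `⊥` and of `⊤`. -/
structure IsTwoClassCongr {L : Type*} [Lattice L] [BoundedOrder L] (r : L → L → Prop) : Prop where
  isLatCongr : IsLatCongr r
  not_rel : ¬ r ⊥ ⊤
  rel_or_rel : ∀ x, r x ⊥ ∨ r x ⊤

namespace IsTwoClassCongr

variable {L : Type*} [Lattice L] [BoundedOrder L] {r s : L → L → Prop}

lemma eq_of_le (hr : IsTwoClassCongr r) (hs : IsLatCongr s) (h : ∀ x y, r x y → s x y)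
    (hs' : ¬ s ⊥ ⊤) : s = r := by
  have hr₁ := hr.isLatCongr.1
  funext x y
  refine propext ⟨fun hxy => ?_, h x y⟩
  rcases hr.rel_or_rel x with hx | hx <;> rcases hr.rel_or_rel y with hy | hy
  · exact hr₁.trans hx (hr₁.symm hy)
  · exact (hs' (hs.1.trans (hs.1.symm (h _ _ hx)) (hs.1.trans hxy (h _ _ hy)))).elim
  · exact (hs' (hs.1.trans (hs.1.symm (h _ _ hy))
      (hs.1.trans (hs.1.symm hxy) (h _ _ hx)))).elim
  · exact hr₁.trans hx (hr₁.symm hy)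

end IsTwoClassCongr

namespace IsLatCongr

variable {L : Type*} [Lattice L] [BoundedOrder L] [Finite L] {r : L → L → Prop}

lemma exists_isTwoClassCongr_rel_top
    (hSD : ∀ x y z : L, x ⊓ y = x ⊓ z → x ⊓ y = x ⊓ (y ⊔ z))
    (hr : IsLatCongr r) {x : L} (hx : ¬ r x ⊥) :
    ∃ s, IsTwoClassCongr s ∧ (∀ y z, r y z → s y z) ∧ s x ⊤ := by
  obtain ⟨a, hax, ha, hs, hrs⟩ := hr.exists_le_isLatCongr_le_iff hSD hx
  refine ⟨_, ⟨hs, by simpa using ha, fun y => ?_⟩, hrs, by simpa using hax⟩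
  by_cases hy : a ≤ y <;> simp [hy, ha]

lemma exists_isTwoClassCongr_rel_bot
    (hSD : ∀ x y z : L, x ⊔ y = x ⊔ z → x ⊔ y = x ⊔ (y ⊓ z))
    (hr : IsLatCongr r) {x : L} (hx : ¬ r x ⊤) :
    ∃ s, IsTwoClassCongr s ∧ (∀ y z, r y z → s y z) ∧ s x ⊥ := by
  obtain ⟨s, hs, hrs, hsx⟩ :=
    exists_isTwoClassCongr_rel_top (L := Lᵒᵈ) (r := r) hSD hr.dual_s16 hx
  exact ⟨s, ⟨hs.isLatCongr.dual_s16, fun h => hs.not_rel (hs.isLatCongr.1.symm h),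
    fun y => (hs.rel_or_rel y).symm⟩, hrs, hsx⟩

/-- A congruence of a finite semidistributive lattice that lies below exactly one two-class
congruence is that congruence. -/
lemma eq_of_unique_isTwoClassCongr
    (hSDinf : ∀ x y z : L, x ⊓ y = x ⊓ z → x ⊓ y = x ⊓ (y ⊔ z))
    (hSDsup : ∀ x y z : L, x ⊔ y = x ⊔ z → x ⊔ y = x ⊔ (y ⊓ z))
    (hr : IsLatCongr r) {s : L → L → Prop} (hs : IsTwoClassCongr s)
    (hrs : ∀ x y, r x y → s x y)
    (huniq : ∀ t, IsTwoClassCongr t → (∀ x y, r x y → t x y) → t = s) : r = s := by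
  have hs₁ := hs.isLatCongr.1
  have of_bot {x : L} (hx : s x ⊥) : r x ⊥ := by
    by_contra h
    obtain ⟨t, ht, hrt, htx⟩ := hr.exists_isTwoClassCongr_rel_top hSDinf h
    rw [huniq t ht hrt] at htx
    exact hs.not_rel (hs₁.trans (hs₁.symm hx) htx)
  have of_top {x : L} (hx : s x ⊤) : r x ⊤ := by
    by_contra h
    obtain ⟨t, ht, hrt, htx⟩ := hr.exists_isTwoClassCongr_rel_bot hSDsup h
    rw [huniq t ht hrt] at htx
    exact hs.not_rel (hs₁.trans (hs₁.symm htx) hx)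
  funext x y
  refine propext ⟨hrs x y, fun hxy => ?_⟩
  rcases hs.rel_or_rel y with hy | hy
  · exact hr.1.trans (of_bot (hs₁.trans hxy hy)) (hr.1.symm (of_bot hy))
  · exact hr.1.trans (of_top (hs₁.trans hxy hy)) (hr.1.symm (of_top hy))

end IsLatCongr

/-- **Theorem 4.35**: a finite distributive lattice with a three-element filter
cannot be the congruence lattice of a finite semidistributive lattice: if `K` is a
finite lattice satisfying both (SD⊓) and (SD⊔), then no filter of the congruence
lattice of `K` (nonempty, upward closed under inclusion, closed under intersection)
has exactly three elements. -/
theorem no_three_element_filter_of_semidistributive {K : Type*} [Lattice K] [Fintype K]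
    (hSDinf : ∀ x y z : K, x ⊓ y = x ⊓ z → x ⊓ y = x ⊓ (y ⊔ z))
    (hSDsup : ∀ x y z : K, x ⊔ y = x ⊔ z → x ⊔ y = x ⊔ (y ⊓ z))
    (F : Set {r : K → K → Prop // IsLatCongr r})
    (hne : F.Nonempty)
    (hup : ∀ a ∈ F, ∀ b : {r : K → K → Prop // IsLatCongr r},
      (∀ x y : K, a.1 x y → b.1 x y) → b ∈ F)
    (hinter : ∀ a ∈ F, ∀ b ∈ F, ∀ c : {r : K → K → Prop // IsLatCongr r},
      (∀ x y : K, c.1 x y ↔ (a.1 x y ∧ b.1 x y)) → c ∈ F) :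
    F.ncard ≠ 3 := by
  classical
  intro hcard
  have hfin : F.Finite := Set.finite_of_ncard_ne_zero (by omega)
  have hinter' {p q : {r : K → K → Prop // IsLatCongr r}} (hp : p ∈ F) (hq : q ∈ F) :
      (⟨_, p.2.inter q.2⟩ : {r : K → K → Prop // IsLatCongr r}) ∈ F :=
    hinter p hp q hq _ fun _ _ => Iff.rfl
  obtain ⟨m, hmF, hm⟩ : ∃ m ∈ F, ∀ p ∈ F, ∀ x y, m.1 x y → p.1 x y := by
    obtain ⟨m, hm⟩ := hfin.exists_minimalFor (fun p => (fun x y => p.1 x y)) F hne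
    exact ⟨m, hm.prop, fun p hp x y h =>
      (hm.le_of_le (hinter' hm.prop hp) (fun _ _ h => h.1) x y h).2⟩
  obtain hK | hK := isEmpty_or_nonempty K
  · have hsub : F ⊆ {m} := fun p _ => Subtype.ext (funext fun x => isEmptyElim x)
    have := Set.ncard_le_ncard hsub
    simp only [Set.ncard_singleton] at this
    omega
  let _ := Fintype.toBoundedOrder K
  let T : {r : K → K → Prop // IsLatCongr r} := ⟨_, IsLatCongr.total⟩
  have hTF : T ∈ F := hup m hmF T fun _ _ _ => trivial
  have eq_T {p : {r : K → K → Prop // IsLatCongr r}} (h : p.1 ⊥ ⊤) : p = T :=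
    Subtype.ext (funext₂ fun x y => eq_true (p.2.rel_of_rel_bot_top h x y))
  have hle_two {s : {r : K → K → Prop // IsLatCongr r}} (hsub : F ⊆ {s, T}) : False := by
    have := (Set.ncard_le_ncard hsub).trans (Set.ncard_insert_le s {T})
    rw [Set.ncard_singleton] at this
    omega
  by_cases hmT : m.1 ⊤ ⊥
  · exact hle_two (s := T) fun p hp => Or.inl (eq_T (p.2.1.symm (hm p hp _ _ hmT)))
  obtain ⟨s, hs, hms, -⟩ := m.2.exists_isTwoClassCongr_rel_top hSDinf hmT
  have hsF : ⟨s, hs.isLatCongr⟩ ∈ F := hup m hmF _ hms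
  have huniq : ∀ t, IsTwoClassCongr t → (∀ x y, m.1 x y → t x y) → t = s := by
    intro t ht hmt
    by_contra hts
    have htF : ⟨t, ht.isLatCongr⟩ ∈ F := hup m hmF _ hmt
    let S : {r : K → K → Prop // IsLatCongr r} := ⟨s, hs.isLatCongr⟩
    let U : {r : K → K → Prop // IsLatCongr r} := ⟨t, ht.isLatCongr⟩
    let I : {r : K → K → Prop // IsLatCongr r} := ⟨_, hs.isLatCongr.inter ht.isLatCongr⟩
    have hTS : T ≠ S := fun h => hs.not_rel (show S.1 ⊥ ⊤ from h ▸ trivial)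
    have hTU : T ≠ U := fun h => ht.not_rel (show U.1 ⊥ ⊤ from h ▸ trivial)
    have hTI : T ≠ I := fun h => hs.not_rel
      (show I.1 ⊥ ⊤ from h ▸ trivial).1
    have hSU : S ≠ U := fun h => hts (congrArg Subtype.val h).symm
    have hSI : S ≠ I := fun h => hts <| hs.eq_of_le ht.isLatCongr
      (fun x y hxy => (show I.1 x y from h ▸ hxy).2) ht.not_rel
    have hUI : U ≠ I := fun h => hts <| .symm <| ht.eq_of_le hs.isLatCongr
      (fun x y hxy => (show I.1 x y from h ▸ hxy).1) hs.not_rel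
    have hsub : (({T, S, U, I} : Finset _) : Set _) ⊆ F := by
      simp only [Finset.coe_insert, Finset.coe_singleton, Set.insert_subset_iff,
        Set.singleton_subset_iff]
      exact ⟨hTF, hsF, htF, hinter' hsF htF⟩
    have := Set.ncard_le_ncard hsub hfin
    rw [Set.ncard_coe_finset] at this
    simp [*] at this
  have hms_eq := m.2.eq_of_unique_isTwoClassCongr hSDinf hSDsup hs hms huniq
  refine hle_two (s := ⟨s, hs.isLatCongr⟩) fun p hp => ?_
  by_cases hpT : p.1 ⊥ ⊤
  · exact Or.inr (eq_T hpT)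
  · exact Or.inl (Subtype.ext (hs.eq_of_le p.2 (hms_eq ▸ hm p hp) hpT))
end

section
/- Let L be a finite lattice with least element 0 satisfying the meet-semidistributive law (SD_⊓), and let a be an atom of L (0 ⋖ a). Then the set P = {x ∈ L : ¬(a ≤ x)} is a prime ideal of L: P is nonempty, P is a proper subset of L, P is a down-set, P is closed under joins (x, y ∈ P implies x ⊔ y ∈ P), and whenever x ⊓ y ∈ P then x ∈ P or y ∈ P. -/
/-- **Lemma 4.36**: if `a` is an atom of a finite meet-semidistributive lattice `L`
with least element `0`, then `P = {x : ¬ a ≤ x}` is a prime ideal: nonempty, proper,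
a down-set, closed under joins, and `x ⊓ y ∈ P` implies `x ∈ P` or `y ∈ P`. -/
theorem atom_gives_prime_ideal {L : Type*} [Lattice L] [OrderBot L] [Fintype L]
    (hSDinf : ∀ x y z : L, x ⊓ y = x ⊓ z → x ⊓ y = x ⊓ (y ⊔ z))
    (a : L) (ha : (⊥ : L) ⋖ a) :
    ({x : L | ¬ a ≤ x}).Nonempty ∧
    {x : L | ¬ a ≤ x} ≠ Set.univ ∧
    (∀ x ∈ {x : L | ¬ a ≤ x}, ∀ y : L, y ≤ x → y ∈ {x : L | ¬ a ≤ x}) ∧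
    (∀ x ∈ {x : L | ¬ a ≤ x}, ∀ y ∈ {x : L | ¬ a ≤ x},
      x ⊔ y ∈ {x : L | ¬ a ≤ x}) ∧
    (∀ x y : L, x ⊓ y ∈ {x : L | ¬ a ≤ x} →
      x ∈ {x : L | ¬ a ≤ x} ∨ y ∈ {x : L | ¬ a ≤ x}) := by
  have hatom : IsAtom a := bot_covBy_iff.mp ha
  refine ⟨⟨⊥, fun h => hatom.1 (le_bot_iff.mp h)⟩, fun h => ?_,
    fun x hx y hyx h => hx (h.trans hyx), fun x hx y hy h => ?_, fun x y h => ?_⟩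
  · exact (h ▸ Set.mem_univ a : a ∈ {x : L | ¬ a ≤ x}) le_rfl
  · have hax : a ⊓ x = ⊥ := (hatom.not_le_iff_disjoint.mp hx).eq_bot
    have hay : a ⊓ y = ⊥ := (hatom.not_le_iff_disjoint.mp hy).eq_bot
    have hsup := hSDinf a x y (hax.trans hay.symm)
    rw [hax, inf_eq_left.mpr h] at hsup
    exact hatom.1 hsup.symm
  · exact not_and_or.mp fun hxy => h (le_inf hxy.1 hxy.2)
end

section
/- Let L be a lattice. (i) A triple (x, y, z) ∈ L³ is Boolean — i.e., satisfies x = (x ⊔ y) ⊓ (x ⊔ z), y = (y ⊔ x) ⊓ (y ⊔ z), and z = (z ⊔ x) ⊓ (z ⊔ y) — if and only if there exist u, v, w ∈ L with x = u ⊓ v, y = u ⊓ w, and z = v ⊓ w. (ii) For every (x, y, z) ∈ L³, the triple ((x ⊔ y) ⊓ (x ⊔ z), (y ⊔ x) ⊓ (y ⊔ z), (z ⊔ x) ⊓ (z ⊔ y)) is Boolean, is componentwise ≥ (x, y, z), and is componentwise ≤ every Boolean triple that is componentwise ≥ (x, y, z); that is, the set of Boolean triples is a closure system in L³ with this triple as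 the closure of (x, y, z). -/
/-- `(x, y, z)` is a Boolean triple of the lattice `L`. -/
def IsBooleanTriple {L : Type*} [Lattice L] (x y z : L) : Prop :=
  x = (x ⊔ y) ⊓ (x ⊔ z) ∧ y = (y ⊔ x) ⊓ (y ⊔ z) ∧ z = (z ⊔ x) ⊓ (z ⊔ y)

theorem isBooleanTriple_inf {L : Type*} [Lattice L] (u v w : L) :
    IsBooleanTriple (u ⊓ v) (u ⊓ w) (v ⊓ w) := by
  refine ⟨le_antisymm (le_inf le_sup_left le_sup_left) ?_,
    le_antisymm (le_inf le_sup_left le_sup_left) ?_,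
    le_antisymm (le_inf le_sup_left le_sup_left) ?_⟩
  · exact inf_le_inf (sup_le inf_le_left inf_le_left) (sup_le inf_le_right inf_le_left)
  · exact inf_le_inf (sup_le inf_le_left inf_le_left) (sup_le inf_le_right inf_le_right)
  · exact inf_le_inf (sup_le inf_le_left inf_le_right) (sup_le inf_le_right inf_le_right)

theorem isBooleanTriple_iff_exists_inf {L : Type*} [Lattice L] {x y z : L} :
    IsBooleanTriple x y z ↔ ∃ u v w : L, x = u ⊓ v ∧ y = u ⊓ w ∧ z = v ⊓ w := by
  constructor
  · rintro ⟨hx, hy, hz⟩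
    refine ⟨x ⊔ y, x ⊔ z, y ⊔ z, hx, ?_, ?_⟩
    · rwa [sup_comm x y]
    · rwa [sup_comm x z, sup_comm y z]
  · rintro ⟨u, v, w, rfl, rfl, rfl⟩
    exact isBooleanTriple_inf u v w

/-- **Lemma 6.1 (i)–(ii)**: (i) a triple is Boolean iff it is of the form
`(u ⊓ v, u ⊓ w, v ⊓ w)`; (ii) the triple
`((x ⊔ y) ⊓ (x ⊔ z), (y ⊔ x) ⊓ (y ⊔ z), (z ⊔ x) ⊓ (z ⊔ y))` is Boolean, lies
componentwise above `(x, y, z)`, and is componentwise below every Boolean triple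
above `(x, y, z)`; i.e. the Boolean triples form a closure system in `L³`. -/
theorem boolean_triples_closure_system {L : Type*} [Lattice L] :
    (∀ x y z : L, IsBooleanTriple x y z ↔
        ∃ u v w : L, x = u ⊓ v ∧ y = u ⊓ w ∧ z = v ⊓ w) ∧
    (∀ x y z : L,
      IsBooleanTriple ((x ⊔ y) ⊓ (x ⊔ z)) ((y ⊔ x) ⊓ (y ⊔ z)) ((z ⊔ x) ⊓ (z ⊔ y)) ∧
      (x ≤ (x ⊔ y) ⊓ (x ⊔ z) ∧ y ≤ (y ⊔ x) ⊓ (y ⊔ z) ∧ z ≤ (z ⊔ x) ⊓ (z ⊔ y)) ∧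
      (∀ a b c : L, IsBooleanTriple a b c → x ≤ a → y ≤ b → z ≤ c →
        (x ⊔ y) ⊓ (x ⊔ z) ≤ a ∧ (y ⊔ x) ⊓ (y ⊔ z) ≤ b ∧ (z ⊔ x) ⊓ (z ⊔ y) ≤ c)) := by
  refine ⟨fun x y z => isBooleanTriple_iff_exists_inf, fun x y z => ⟨?_, ?_, ?_⟩⟩
  · rw [sup_comm y x, sup_comm z x, sup_comm z y]
    exact isBooleanTriple_inf _ _ _
  · exact ⟨le_inf le_sup_left le_sup_left, le_inf le_sup_left le_sup_left,
      le_inf le_sup_left le_sup_left⟩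
  · rintro a b c ⟨ha, hb, hc⟩ hxa hyb hzc
    exact ⟨(inf_le_inf (sup_le_sup hxa hyb) (sup_le_sup hxa hzc)).trans_eq ha.symm,
      (inf_le_inf (sup_le_sup hyb hxa) (sup_le_sup hyb hzc)).trans_eq hb.symm,
      (inf_le_inf (sup_le_sup hzc hxa) (sup_le_sup hzc hyb)).trans_eq hc.symm⟩
end
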